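/- arXiv:2301.08137 — 9 statements merged into one kernel-verified Lean document; each statement's English description precedes it below -/
import Mathlib

section
/- Let (S, P) be a finite Markov chain. For every initial state s ∈ S, the set of infinite paths ω ∈ S^ℕ for which there exists a bottom strongly connected component R of (S,P) and an index n₀ ∈ ℕ such that ω(n) ∈ R for all n > n₀ has ℙ_s-probability 1; i.e., almost every path eventually remains forever inside one single BSCC. -/
open Finset Filter Topology MeasureTheory

/-- `P` is a row-stochastic transition matrix. -/
def IsStochastic {S : Type*} [Fintype S] (P : Matrix S S ℝ) : Prop :=
  (∀ s s', 0 ≤ P s s') ∧ ∀ s, ∑ s', P s s' = 1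

/-- `R` is a bottom strongly connected component of the transition graph of `P`:
a nonempty, maximal strongly connected set of states with no transitions leaving it. -/
def IsBSCC {S : Type*} [Fintype S] (P : Matrix S S ℝ) (R : Finset S) : Prop :=
  R.Nonempty ∧
  (∀ a ∈ R, ∀ b ∈ R, Relation.ReflTransGen (fun x y => 0 < P x y) a b) ∧
  (∀ C : Finset S, R ⊆ C →
    (∀ a ∈ C, ∀ b ∈ C, Relation.ReflTransGen (fun x y => 0 < P x y) a b) → C = R) ∧
  (∀ s ∈ R, ∀ s' ∉ R, P s s' = 0)

/-- The states from which every reachable state leads back: exactly the states lying in a BSCC. -/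
def IsRecurrentState {S : Type*} (P : Matrix S S ℝ) (r : S) : Prop :=
  ∀ x, Relation.ReflTransGen (fun x y => 0 < P x y) r x →
    Relation.ReflTransGen (fun x y => 0 < P x y) x r

lemma exists_reachable_isRecurrentState {S : Type*} [Finite S] (P : Matrix S S ℝ) (s : S) :
    ∃ r, Relation.ReflTransGen (fun x y => 0 < P x y) s r ∧ IsRecurrentState P r := by
  obtain ⟨r, hr, hmin⟩ := (Set.toFinite {r | Relation.ReflTransGen (fun x y => 0 < P x y) s r}
    ).exists_minimalFor (fun r => {x | Relation.ReflTransGen (fun x y => 0 < P x y) r x}) _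
    ⟨s, Relation.ReflTransGen.refl⟩
  exact ⟨r, hr, fun x hx => hmin (hr.trans hx) (fun y hy => hx.trans hy)
    Relation.ReflTransGen.refl⟩

open Classical in
lemma IsRecurrentState.isBSCC {S : Type*} [Fintype S] {P : Matrix S S ℝ}
    (hP : ∀ s s', 0 ≤ P s s') {r : S} (hr : IsRecurrentState P r) :
    IsBSCC P {x | Relation.ReflTransGen (fun x y => 0 < P x y) r x} := by
  refine ⟨⟨r, by simp [Relation.ReflTransGen.refl]⟩, fun a ha b hb => ?_, fun C hRC hC => ?_,
    fun a ha b hb => ?_⟩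
  · simp only [Finset.mem_filter, Finset.mem_univ, true_and] at ha hb
    exact (hr a ha).trans hb
  · refine Finset.Subset.antisymm (fun c hc => ?_) hRC
    have hrC : r ∈ C := hRC (by simp [Relation.ReflTransGen.refl])
    simpa using hC r hrC c hc
  · simp only [Finset.mem_filter, Finset.mem_univ, true_and] at ha hb
    exact ((hP a b).eq_or_lt.resolve_right fun h => hb (ha.tail h)).symm

open Classical in
/-- The probability that the chain started at a state stays in `T` during its first `n` steps. -/
noncomputable def stayProb {S : Type*} [Fintype S] (P : Matrix S S ℝ) (T : Set S) : ℕ → S → ℝ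
  | 0, s => if s ∈ T then 1 else 0
  | n + 1, s => if s ∈ T then ∑ b, P s b * stayProb P T n b else 0

lemma stayProb_nonneg {S : Type*} [Fintype S] {P : Matrix S S ℝ} (hP : ∀ s s', 0 ≤ P s s')
    (T : Set S) (n : ℕ) (s : S) : 0 ≤ stayProb P T n s := by
  induction n generalizing s with
  | zero => unfold stayProb; split_ifs <;> norm_num
  | succ n ih =>
    unfold stayProb
    split_ifs
    · exact Finset.sum_nonneg fun b _ => mul_nonneg (hP s b) (ih b)
    · exact le_rfl

lemma stayProb_succ_le {S : Type*} [Fintype S] {P : Matrix S S ℝ} (hP : IsStochastic P)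
    (T : Set S) (n : ℕ) (s : S) : stayProb P T (n + 1) s ≤ stayProb P T n s := by
  induction n generalizing s with
  | zero =>
    simp only [stayProb]
    split_ifs
    · refine (Finset.sum_le_sum fun b _ =>
        mul_le_of_le_one_right (hP.1 s b) ?_).trans_eq (hP.2 s)
      split_ifs <;> norm_num
    · exact le_rfl
  | succ n ih =>
    rw [stayProb, stayProb]
    split_ifs
    · exact Finset.sum_le_sum fun b _ => mul_le_mul_of_nonneg_left (ih b) (hP.1 s b)
    · exact le_rfl

/-- If every state can reach the complement of `T`, the chain leaves `T` almost surely. -/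
lemma tendsto_stayProb {S : Type*} [Fintype S] {P : Matrix S S ℝ} (hP : IsStochastic P)
    {T : Set S} (hT : ∀ s, ∃ r ∉ T, Relation.ReflTransGen (fun x y => 0 < P x y) s r) (s : S) :
    Tendsto (fun n => stayProb P T n s) atTop (𝓝 0) := by
  classical
  have hlim (a : S) : Tendsto (fun n => stayProb P T n a) atTop (𝓝 (⨅ n, stayProb P T n a)) :=
    tendsto_atTop_ciInf (antitone_nat_of_succ_le fun n => stayProb_succ_le hP T n a)
      ⟨0, by rintro _ ⟨n, rfl⟩; exact stayProb_nonneg hP.1 T n a⟩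
  set L : S → ℝ := fun a => ⨅ n, stayProb P T n a
  have hL0 (a : S) : 0 ≤ L a := ge_of_tendsto' (hlim a) fun n => stayProb_nonneg hP.1 T n a
  have hfix (a : S) : L a = if a ∈ T then ∑ b, P a b * L b else 0 := by
    refine tendsto_nhds_unique ((tendsto_add_atTop_iff_nat 1).2 (hlim a)) ?_
    simp only [stayProb]
    split_ifs
    · exact tendsto_finsetSum _ fun b _ => (hlim b).const_mul _
    · exact tendsto_const_nhds
  obtain ⟨m, -, hm⟩ := Finset.exists_max_image Finset.univ L ⟨s, Finset.mem_univ s⟩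
  have hLm : L m = 0 := by
    by_contra hne
    have key (r : S) (hr : Relation.ReflTransGen (fun x y => 0 < P x y) m r) : L r = L m := by
      induction hr with
      | refl => rfl
      | @tail a b _ hab ih =>
        have haT : a ∈ T := by
          by_contra h
          exact hne (by rw [← ih, hfix a, if_neg h])
        have hsum : ∑ c, P a c * (L m - L c) = 0 := by
          have h := hfix a
          rw [if_pos haT, ih] at h
          simp only [mul_sub, Finset.sum_sub_distrib, ← Finset.sum_mul, hP.2 a]
          linarith
        have h0 := (Finset.sum_eq_zero_iff_of_nonneg fun c _ =>
          mul_nonneg (hP.1 a c) (sub_nonneg.2 (hm c (Finset.mem_univ c)))).1 hsum b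
          (Finset.mem_univ b)
        linarith [(mul_eq_zero.1 h0).resolve_left hab.ne']
    obtain ⟨r, hrT, hr⟩ := hT m
    exact hne (by rw [← key r hr, hfix r, if_neg hrT])
  have hLs : L s = 0 := le_antisymm (hLm ▸ hm s (Finset.mem_univ s)) (hL0 s)
  exact hLs ▸ hlim s

section Trajectory

variable {S : Type*} [Fintype S] [MeasurableSpace S] {P : Matrix S S ℝ} {ν : Measure (ℕ → S)}

lemma measure_cylinder_inter_stay_le (hP : ∀ s s', 0 ≤ P s s')
    (hν : ∀ (n : ℕ) (w : ℕ → S), ν {ω | ∀ i ≤ n + 1, ω i = w i} =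
      ν {ω | ∀ i ≤ n, ω i = w i} * ENNReal.ofReal (P (w n) (w (n + 1))))
    (T : Set S) (n k : ℕ) (w : ℕ → S) :
    ν {ω | (∀ i ≤ k, ω i = w i) ∧ ∀ i, k ≤ i → i ≤ k + n → ω i ∈ T} ≤
      ν {ω | ∀ i ≤ k, ω i = w i} * ENNReal.ofReal (stayProb P T n (w k)) := by
  classical
  by_cases hk : w k ∈ T
  swap
  · refine (measure_mono_null (t := ∅) ?_ measure_empty).le.trans zero_le
    rintro ω ⟨h, h'⟩
    exact hk (h k le_rfl ▸ h' k le_rfl (by omega))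
  induction n generalizing k w with
  | zero =>
    simp only [stayProb, if_pos hk, ENNReal.ofReal_one, mul_one]
    exact measure_mono fun ω h => h.1
  | succ n ih =>
    let w' (b : S) : ℕ → S := Function.update w (k + 1) b
    have hw' (b : S) (i : ℕ) (hi : i ≤ k) : w' b i = w i :=
      Function.update_of_ne (by omega) _ _
    have hwk (b : S) : w' b (k + 1) = b := Function.update_self _ _ _
    have hcyl (b : S) : {ω : ℕ → S | ∀ i ≤ k, ω i = w' b i} = {ω | ∀ i ≤ k, ω i = w i} := by
      ext ω
      exact forall₂_congr fun i hi => by rw [hw' b i hi]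
    calc _ ≤ ν (⋃ b, {ω | (∀ i ≤ k + 1, ω i = w' b i) ∧
            ∀ i, k + 1 ≤ i → i ≤ k + 1 + n → ω i ∈ T}) := by
          refine measure_mono ?_
          rintro ω ⟨h, h'⟩
          refine Set.mem_iUnion.2 ⟨ω (k + 1), fun i hi => ?_, fun i hi hi' =>
            h' i (by omega) (by omega)⟩
          rcases Nat.le_succ_iff.1 hi with hi | rfl
          · rw [hw' _ i hi, h i hi]
          · rw [hwk]
      _ ≤ ∑ b, ν {ω | (∀ i ≤ k + 1, ω i = w' b i) ∧
            ∀ i, k + 1 ≤ i → i ≤ k + 1 + n → ω i ∈ T} := measure_iUnion_fintype_le _ _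
      _ ≤ ∑ b, ν {ω | ∀ i ≤ k, ω i = w i} *
            ENNReal.ofReal (P (w k) b * stayProb P T n b) := by
          refine Finset.sum_le_sum fun b _ => ?_
          by_cases hb : b ∈ T
          · refine (ih (k + 1) (w' b) (by rwa [hwk])).trans_eq ?_
            rw [hν, hcyl, hwk, hw' b k le_rfl, mul_assoc, ENNReal.ofReal_mul (hP _ _)]
          · refine (measure_mono_null (t := ∅) ?_ measure_empty).le.trans zero_le
            rintro ω ⟨h, h'⟩
            exact hb (hwk b ▸ h (k + 1) le_rfl ▸ h' (k + 1) le_rfl (by omega))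
      _ = _ := by
          rw [← Finset.mul_sum, ← ENNReal.ofReal_sum_of_nonneg fun b _ =>
            mul_nonneg (hP _ _) (stayProb_nonneg hP T n b), stayProb, if_pos hk]

lemma ae_exists_not_mem [IsProbabilityMeasure ν] (hP : IsStochastic P)
    (hν : ∀ (n : ℕ) (w : ℕ → S), ν {ω | ∀ i ≤ n + 1, ω i = w i} =
      ν {ω | ∀ i ≤ n, ω i = w i} * ENNReal.ofReal (P (w n) (w (n + 1))))
    {T : Set S} (hT : ∀ s, ∃ r ∉ T, Relation.ReflTransGen (fun x y => 0 < P x y) s r) :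
    ∀ᵐ ω ∂ν, ∃ n, ω n ∉ T := by
  have hstart (a : S) : ∀ᵐ ω ∂ν, ω 0 = a → ∃ n, ω n ∉ T := by
    have hlim : Tendsto (fun n => ENNReal.ofReal (stayProb P T n a)) atTop (𝓝 0) := by
      simpa [Function.comp_def] using
        (ENNReal.continuous_ofReal.tendsto 0).comp (tendsto_stayProb hP hT a)
    refine le_antisymm (ge_of_tendsto' hlim fun n => ?_) zero_le
    refine (measure_mono ?_).trans ((measure_cylinder_inter_stay_le hP.1 hν T n 0
      fun _ => a).trans (mul_le_of_le_one_left zero_le prob_le_one))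
    intro ω hω
    simp only [Set.mem_compl_iff, Set.mem_ofPred_eq, not_forall, not_exists, not_not] at hω
    obtain ⟨h0, h⟩ := hω
    exact ⟨fun i hi => by rw [Nat.le_zero.1 hi, h0], fun i _ _ => h i⟩
  filter_upwards [ae_all_iff.2 hstart] with ω hω using hω _ rfl

lemma ae_measure_cylinder_ne_zero (n : ℕ) : ∀ᵐ ω ∂ν, ν {ω' | ∀ i ≤ n, ω' i = ω i} ≠ 0 := by
  have h (v : Fin (n + 1) → S) :
      ∀ᵐ ω ∂ν, (∀ i : Fin (n + 1), ω i = v i) → ν {ω' | ∀ i ≤ n, ω' i = ω i} ≠ 0 := by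
    by_cases hv : ∃ ω₀ : ℕ → S, (∀ i : Fin (n + 1), ω₀ i = v i) ∧
        ν {ω' | ∀ i ≤ n, ω' i = ω₀ i} = 0
    · obtain ⟨ω₀, hω₀, h0⟩ := hv
      refine measure_mono_null ?_ h0
      intro ω hω i hi
      simp only [Set.mem_compl_iff, Set.mem_ofPred_eq, not_forall] at hω
      exact (hω.1 ⟨i, by omega⟩).trans (hω₀ ⟨i, by omega⟩).symm
    · push Not at hv
      exact Eventually.of_forall hv
  filter_upwards [ae_all_iff.2 h] with ω hω using hω _ fun _ => rfl

end Trajectory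

/-- Almost every path of a finite Markov chain eventually remains forever inside
one single BSCC. The measure `μ s` is the canonical trajectory measure started
at `s`, characterized by its values on cylinder sets. -/
theorem stmt0 {S : Type*} [Fintype S] [DecidableEq S] [Nonempty S]
    [MeasurableSpace S] [MeasurableSingletonClass S]
    (P : Matrix S S ℝ) (hP : IsStochastic P)
    (μ : S → Measure (ℕ → S)) (hμ : ∀ s, IsProbabilityMeasure (μ s))
    (hcyl : ∀ (s : S) (n : ℕ) (w : ℕ → S),
      μ s {ω | ∀ i ≤ n, ω i = w i} =
        (if w 0 = s then 1 else 0) *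
          ∏ i ∈ Finset.range n, ENNReal.ofReal (P (w i) (w (i + 1))))
    (s : S) :
    μ s {ω | ∃ R : Finset S, IsBSCC P R ∧ ∃ n₀ : ℕ, ∀ n > n₀, ω n ∈ R} = 1 := by
  classical
  have hν (n : ℕ) (w : ℕ → S) : μ s {ω | ∀ i ≤ n + 1, ω i = w i} =
      μ s {ω | ∀ i ≤ n, ω i = w i} * ENNReal.ofReal (P (w n) (w (n + 1))) := by
    rw [hcyl, hcyl, Finset.prod_range_succ, mul_assoc]
  have hT (a : S) : ∃ r ∉ {r | ¬ IsRecurrentState P r},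
      Relation.ReflTransGen (fun x y => 0 < P x y) a r := by
    obtain ⟨r, har, hr⟩ := exists_reachable_isRecurrentState P a
    exact ⟨r, not_not.2 hr, har⟩
  refine (measure_congr (eventuallyEq_univ.2 ?_)).trans measure_univ
  filter_upwards [ae_exists_not_mem hP hν hT,
    ae_all_iff.2 fun n => ae_measure_cylinder_ne_zero (ν := μ s) n] with ω ⟨n, hn⟩ hpos
  have hedge (m : ℕ) : 0 < P (ω m) (ω (m + 1)) := by
    have h := hpos (m + 1)
    rw [hν] at h
    exact ENNReal.ofReal_pos.1 (pos_iff_ne_zero.2 (right_ne_zero_of_mul h))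
  refine ⟨_, IsRecurrentState.isBSCC hP.1 (not_not.1 hn), n, fun m hm => ?_⟩
  simp only [Finset.mem_filter, Finset.mem_univ, true_and]
  induction m, hm.le using Nat.le_induction with
  | base => exact Relation.ReflTransGen.refl
  | succ m hnm ih =>
    rcases hnm.eq_or_lt with rfl | h
    · exact Relation.ReflTransGen.single (hedge _)
    · exact (ih h).tail (hedge m)
end

section
/- Let (S, P) be a finite Markov chain and let R be a bottom strongly connected component of (S,P). Then for all states s, s' ∈ R, the set of infinite paths ω ∈ S^ℕ that visit s', i.e. {ω | ∃ n ∈ ℕ, ω(n) = s'}, has ℙ_s-probability 1. -/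
open Finset Filter Topology MeasureTheory

open scoped ENNReal

section FirstStepAnalysis

variable {S : Type*} [Fintype S] [DecidableEq S]

/-- Total weight, over words of length `n + 1` starting at `s`, of the product of the transition
weights `p` along the word and of the letter weights `c`. -/
noncomputable def weightedPathSum (p : S → S → ℝ≥0∞) (c : S → ℝ≥0∞) (n : ℕ) (s : S) : ℝ≥0∞ :=
  ∑ w : Fin (n + 1) → S, (if w 0 = s then 1 else 0) *
    (∏ i : Fin n, p (w i.castSucc) (w i.succ)) * ∏ i, c (w i)

theorem weightedPathSum_succ (p : S → S → ℝ≥0∞) (c : S → ℝ≥0∞) (n : ℕ) (s : S) :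
    weightedPathSum p c (n + 1) s = c s * ∑ t, p s t * weightedPathSum p c n t := by
  have hleft : weightedPathSum p c (n + 1) s = ∑ w : Fin (n + 1) → S,
      c s * (p s (w 0) * ((∏ i : Fin n, p (w i.castSucc) (w i.succ)) * ∏ i, c (w i))) := by
    unfold weightedPathSum
    rw [← (Fin.consEquiv fun _ : Fin (n + 2) => S).sum_comp, Fintype.sum_prod_type,
      Finset.sum_comm]
    refine Finset.sum_congr rfl fun w _ => ?_
    rw [Finset.sum_eq_single s]
    · simp [Fin.consEquiv, Fin.prod_univ_succ (n := n + 1), Fin.prod_univ_succ (n := n)]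
      ring
    · intro b _ hb
      simp [Fin.consEquiv, hb]
    · simp
  have hright : ∑ t, p s t * weightedPathSum p c n t = ∑ w : Fin (n + 1) → S,
      p s (w 0) * ((∏ i : Fin n, p (w i.castSucc) (w i.succ)) * ∏ i, c (w i)) := by
    simp only [weightedPathSum, Finset.mul_sum]
    rw [Finset.sum_comm]
    refine Finset.sum_congr rfl fun w _ => ?_
    rw [Finset.sum_eq_single (w 0)]
    · simp
    · intro b _ hb
      simp [hb.symm]
    · simp
  rw [hleft, hright, Finset.mul_sum]

variable [MeasurableSpace S] [MeasurableSingletonClass S]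

theorem measure_avoid_eq_weightedPathSum {p : S → S → ℝ≥0∞} {s : S} {μ : Measure (ℕ → S)}
    (hcyl : ∀ (n : ℕ) (w : ℕ → S), μ {ω | ∀ i ≤ n, ω i = w i} =
      (if w 0 = s then 1 else 0) * ∏ i ∈ Finset.range n, p (w i) (w (i + 1)))
    (s' : S) (n : ℕ) :
    μ {ω | ∀ i ≤ n, ω i ≠ s'} = weightedPathSum p (fun x => if x = s' then 0 else 1) n s := by
  let f : (ℕ → S) → Fin (n + 1) → S := fun ω i => ω i
  have hf : Measurable f := by fun_prop
  have hset : {ω : ℕ → S | ∀ i ≤ n, ω i ≠ s'} =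
      f ⁻¹' ((Finset.univ.filter fun w : Fin (n + 1) → S => ∀ i, w i ≠ s' : Finset _) :
        Set (Fin (n + 1) → S)) := by
    ext ω
    simp [f, Fin.forall_iff]
  rw [hset, ← sum_measure_preimage_singleton _ fun w _ => hf (measurableSet_singleton w),
    Finset.sum_filter]
  refine Finset.sum_congr rfl fun w _ => ?_
  have hw : f ⁻¹' {w} = {ω | ∀ i ≤ n, ω i = w (Fin.ofNat (n + 1) i)} := by
    ext ω
    simp only [Set.mem_preimage, Set.mem_singleton_iff, funext_iff, Fin.forall_iff, f,
      Set.mem_ofPred_eq, Nat.lt_succ_iff]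
    refine forall₂_congr fun i hi => ?_
    rw [show Fin.ofNat (n + 1) i = ⟨i, Nat.lt_succ_of_le hi⟩ from
      Fin.ext (Nat.mod_eq_of_lt (Nat.lt_succ_of_le hi))]
  have hprod : ∏ i, (if w i = s' then (0 : ℝ≥0∞) else 1) = if ∀ i, w i ≠ s' then 1 else 0 := by
    split_ifs with h
    · exact Finset.prod_eq_one fun i _ => if_neg (h i)
    · push Not at h
      obtain ⟨i, hi⟩ := h
      exact Finset.prod_eq_zero (Finset.mem_univ i) (if_pos hi)
  rw [hprod, hw, hcyl, Finset.prod_range]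
  have hstep (i : Fin n) : p (w (Fin.ofNat (n + 1) i)) (w (Fin.ofNat (n + 1) (i + 1))) =
      p (w i.castSucc) (w i.succ) := by
    congr 2 <;> ext <;> simp
  simp only [hstep]
  split_ifs <;> simp_all

/-- The probability of never visiting `s'` is harmonic away from `s'`. -/
theorem measure_never_visit_eq_sum {p : S → S → ℝ≥0∞} (hp : ∀ s t, p s t ≠ ∞)
    {μ : S → Measure (ℕ → S)} [∀ s, IsFiniteMeasure (μ s)]
    (hcyl : ∀ (s : S) (n : ℕ) (w : ℕ → S), μ s {ω | ∀ i ≤ n, ω i = w i} =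
      (if w 0 = s then 1 else 0) * ∏ i ∈ Finset.range n, p (w i) (w (i + 1)))
    {s s' : S} (hs : s ≠ s') :
    μ s {ω | ∀ n, ω n ≠ s'} = ∑ t, p s t * μ t {ω | ∀ n, ω n ≠ s'} := by
  have hlim (t : S) : Tendsto (fun n : ℕ => μ t {ω | ∀ i ≤ n, ω i ≠ s'}) atTop
      (𝓝 (μ t {ω | ∀ n, ω n ≠ s'})) := by
    have hInter : {ω : ℕ → S | ∀ n, ω n ≠ s'} = ⋂ n : ℕ, {ω : ℕ → S | ∀ i ≤ n, ω i ≠ s'} := by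
      ext ω
      simp only [Set.mem_ofPred_eq, Set.mem_iInter]
      exact ⟨fun h _ i _ => h i, fun h n => h n n le_rfl⟩
    rw [hInter]
    refine tendsto_measure_iInter_atTop (fun n => MeasurableSet.nullMeasurableSet ?_)
      (fun m n hmn ω hω i hi => hω i (hi.trans hmn)) ⟨0, measure_ne_top _ _⟩
    have : {ω : ℕ → S | ∀ i ≤ n, ω i ≠ s'} = ⋂ i ≤ n, (fun ω => ω i) ⁻¹' {s'}ᶜ := by
      ext ω
      simp
    rw [this]
    exact MeasurableSet.iInter fun i => MeasurableSet.iInter fun _ =>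
      measurable_pi_apply i (measurableSet_singleton s').compl
  have hrec (n : ℕ) : μ s {ω | ∀ i ≤ n + 1, ω i ≠ s'} =
      ∑ t, p s t * μ t {ω | ∀ i ≤ n, ω i ≠ s'} := by
    simp only [fun t n => measure_avoid_eq_weightedPathSum (hcyl t) s' n]
    rw [weightedPathSum_succ, if_neg hs, one_mul]
  refine tendsto_nhds_unique ((hlim s).comp (tendsto_add_atTop_nat 1)) ?_
  simp only [Function.comp_def, hrec]
  exact tendsto_finsetSum _ fun t _ => ENNReal.Tendsto.const_mul (hlim t) (Or.inr (hp s t))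

end FirstStepAnalysis

/-- Maximum principle: a function that vanishes at `s'` and is harmonic on `R \ {s'}`, where `R` is
closed and every state of `R` leads to `s'`, is nonpositive on `R`. -/
theorem nonpos_of_harmonic_of_reachable {S : Type*} [Fintype S] {P : Matrix S S ℝ}
    (hP : IsStochastic P) {R : Finset S} (hclosed : ∀ s ∈ R, ∀ t ∉ R, P s t = 0) {s' : S}
    (hreach : ∀ a ∈ R, Relation.ReflTransGen (fun x y => 0 < P x y) a s')
    {h : S → ℝ} (h_zero : h s' = 0)
    (h_harm : ∀ a ∈ R, a ≠ s' → h a = ∑ t, P a t * h t) {s : S} (hs : s ∈ R) : h s ≤ 0 := by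
  obtain ⟨m, hmR, hmax⟩ := R.exists_max_image h ⟨s, hs⟩
  suffices hm : ∀ a, Relation.ReflTransGen (fun x y => 0 < P x y) a s' → a ∈ R → h a = h m →
      h m = 0 from (hmax s hs).trans (hm m (hreach m hmR) hmR rfl).le
  intro a ha
  induction ha using Relation.ReflTransGen.head_induction_on with
  | refl => exact fun _ e => e ▸ h_zero
  | @head a b hab _ ih =>
    intro haR hae
    by_cases has : a = s'
    · rw [← hae, has, h_zero]
    have hbR : b ∈ R := by
      by_contra hb
      exact hab.ne' (hclosed a haR b hb)
    have hsum : ∑ t, P a t * (h m - h t) = 0 := by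
      simp only [mul_sub, Finset.sum_sub_distrib, ← Finset.sum_mul, hP.2 a, ← h_harm a haR has, hae]
      ring
    have hnonneg (t : S) (_ : t ∈ Finset.univ) : 0 ≤ P a t * (h m - h t) := by
      by_cases ht : t ∈ R
      · exact mul_nonneg (hP.1 a t) (sub_nonneg.2 (hmax t ht))
      · rw [hclosed a haR t ht, zero_mul]
    have hb := (Finset.sum_eq_zero_iff_of_nonneg hnonneg).1 hsum b (Finset.mem_univ b)
    exact ih hbR (sub_eq_zero.1 ((mul_eq_zero.1 hb).resolve_left hab.ne')).symm

/-- Inside a BSCC, every state is visited (indeed reached) with probability one: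
for `s, s'` in a BSCC `R`, the set of paths started at `s` that visit `s'` has
probability 1. The measure `μ s` is the canonical trajectory measure started at
`s`, characterized by its values on cylinder sets. -/
theorem stmt1 {S : Type*} [Fintype S] [DecidableEq S] [Nonempty S]
    [MeasurableSpace S] [MeasurableSingletonClass S]
    (P : Matrix S S ℝ) (hP : IsStochastic P)
    (μ : S → Measure (ℕ → S)) (hμ : ∀ s, IsProbabilityMeasure (μ s))
    (hcyl : ∀ (s : S) (n : ℕ) (w : ℕ → S),
      μ s {ω | ∀ i ≤ n, ω i = w i} =
        (if w 0 = s then 1 else 0) *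
          ∏ i ∈ Finset.range n, ENNReal.ofReal (P (w i) (w (i + 1))))
    (R : Finset S) (hR : IsBSCC P R)
    (s s' : S) (hs : s ∈ R) (hs' : s' ∈ R) :
    μ s {ω | ∃ n : ℕ, ω n = s'} = 1 := by
  have hzero : (μ s).real {ω | ∀ n, ω n ≠ s'} = 0 := by
    refine le_antisymm (nonpos_of_harmonic_of_reachable
      (h := fun t => (μ t).real {ω | ∀ n, ω n ≠ s'}) hP hR.2.2.2
      (fun a ha => hR.2.1 a ha s' hs') ?_ (fun a _ ha => ?_) hs) measureReal_nonneg
    · have h0 : μ s' {ω | ∀ i ≤ 0, ω i ≠ s'} = 0 := by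
        rw [measure_avoid_eq_weightedPathSum (p := fun x y => ENNReal.ofReal (P x y)) (hcyl s')]
        refine Finset.sum_eq_zero fun w _ => ?_
        by_cases hw : w 0 = s' <;> simp [hw]
      have hsub : {ω : ℕ → S | ∀ n, ω n ≠ s'} ⊆ {ω | ∀ i ≤ 0, ω i ≠ s'} := fun _ hω i _ => hω i
      rw [measureReal_def, measure_mono_null hsub h0, ENNReal.toReal_zero]
    · simp only [measureReal_def]
      rw [measure_never_visit_eq_sum (p := fun x y => ENNReal.ofReal (P x y))
        (fun _ _ => ENNReal.ofReal_ne_top) hcyl ha, ENNReal.toReal_sum fun t _ =>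
          ENNReal.mul_ne_top ENNReal.ofReal_ne_top (measure_ne_top _ _)]
      simp [ENNReal.toReal_mul, ENNReal.toReal_ofReal (hP.1 _ _)]
  have hcompl : {ω : ℕ → S | ∃ n, ω n = s'}ᶜ = {ω | ∀ n, ω n ≠ s'} := by
    ext ω
    simp
  rw [← prob_compl_eq_zero_iff, hcompl]
  · exact (measureReal_eq_zero_iff).1 hzero
  · rw [Set.ofPred_exists]
    exact MeasurableSet.iUnion fun n => measurableSet_eq_fun (measurable_pi_apply n) measurable_const
end

section
/- Let (S, P) be a finite Markov chain. For every initial state ŝ ∈ S and every s ∈ S, the Cesàro limit π_ŝ(s) = lim_{n→∞} (1/n) Σ_{i=1}^n P^i(ŝ,s) exists; moreover π_ŝ is a probability distribution on S (π_ŝ(s) ≥ 0 for all s and Σ_{s∈S} π_ŝ(s) = 1) and it is stationary, i.e. Σ_{s∈S} π_ŝ(s) P(s,t) = π_ŝ(t) for every t ∈ S. -/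
open Finset Filter Topology

/-- The Cesàro averages `(1/n) ∑_{i=1}^n P^i` of the powers of a matrix. -/
noncomputable def cesaroAverage {S : Type*} [Fintype S] [DecidableEq S]
    (P : Matrix S S ℝ) (n : ℕ) : Matrix S S ℝ :=
  (n : ℝ)⁻¹ • ∑ i ∈ Finset.Icc 1 n, P ^ i

section CesaroAverage

variable {S : Type*} [Fintype S] [DecidableEq S] {P : Matrix S S ℝ}

theorem isCompact_rowStochastic :
    IsCompact (Matrix.rowStochastic ℝ S : Set (Matrix S S ℝ)) := by
  have hbox : IsCompact (Set.Icc (0 : S → S → ℝ) 1) := isCompact_Icc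
  refine hbox.of_isClosed_subset ?_ fun M hM =>
    ⟨fun i j => Matrix.nonneg_of_mem_rowStochastic hM,
      fun i j => Matrix.le_one_of_mem_rowStochastic hM⟩
  have hset : (Matrix.rowStochastic ℝ S : Set (Matrix S S ℝ)) =
      (⋂ i, ⋂ j, {M | 0 ≤ M i j}) ∩ {M | M.mulVec 1 = 1} := by
    ext M
    simp [Matrix.mem_rowStochastic]
  rw [hset]
  refine IsClosed.inter ?_ (isClosed_eq (by fun_prop) continuous_const)
  exact isClosed_iInter fun i => isClosed_iInter fun j =>
    isClosed_le continuous_const (by fun_prop)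

theorem cesaroAverage_mem_rowStochastic (hP : P ∈ Matrix.rowStochastic ℝ S) {n : ℕ}
    (hn : n ≠ 0) : cesaroAverage P n ∈ Matrix.rowStochastic ℝ S := by
  rw [cesaroAverage, Finset.smul_sum]
  refine Matrix.convex_rowStochastic.sum_mem (fun _ _ => by positivity) ?_
    fun i _ => pow_mem hP i
  simp [hn]

theorem commute_cesaroAverage (P : Matrix S S ℝ) (n : ℕ) : Commute P (cesaroAverage P n) :=
  (Commute.sum_right _ _ _ fun i _ => Commute.self_pow P i).smul_right _

theorem mul_cesaroAverage_sub (P : Matrix S S ℝ) (n : ℕ) :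
    P * cesaroAverage P n - cesaroAverage P n = (n : ℝ)⁻¹ • (P ^ (n + 1) - P) := by
  rw [cesaroAverage, mul_smul_comm, ← smul_sub, Finset.mul_sum, ← Finset.sum_sub_distrib]
  congr 1
  induction n with
  | zero => simp
  | succ n ih => rw [Finset.sum_Icc_succ_top (by omega), ih, ← pow_succ']; abel

theorem tendsto_mul_cesaroAverage_sub (hP : P ∈ Matrix.rowStochastic ℝ S) :
    Tendsto (fun n => P * cesaroAverage P n - cesaroAverage P n) atTop (𝓝 0) := by
  simp only [mul_cesaroAverage_sub]
  refine tendsto_pi_nhds.2 fun i => tendsto_pi_nhds.2 fun j => ?_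
  refine squeeze_zero_norm (fun n => ?_) tendsto_inv_atTop_nhds_zero_nat
  have hpow : P ^ (n + 1) ∈ Matrix.rowStochastic ℝ S := pow_mem hP _
  have hle : |(P ^ (n + 1)) i j - P i j| ≤ 1 :=
    abs_sub_le_of_nonneg_of_le (Matrix.nonneg_of_mem_rowStochastic hpow)
      (Matrix.le_one_of_mem_rowStochastic hpow) (Matrix.nonneg_of_mem_rowStochastic hP)
      (Matrix.le_one_of_mem_rowStochastic hP)
  rw [Matrix.smul_apply, Matrix.sub_apply, norm_smul, Real.norm_eq_abs, Real.norm_eq_abs,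
    abs_of_nonneg (by positivity : (0 : ℝ) ≤ (n : ℝ)⁻¹)]
  exact mul_le_of_le_one_right (by positivity) hle

/-- A cluster point of the Cesàro averages of `P` is a fixed point of multiplication by `P`. -/
theorem mul_eq_of_mapClusterPt_cesaroAverage (hP : P ∈ Matrix.rowStochastic ℝ S)
    {Q : Matrix S S ℝ} (hQ : MapClusterPt Q atTop (cesaroAverage P)) :
    P * Q = Q ∧ Q * P = Q := by
  obtain ⟨U, hU, hlim⟩ := mapClusterPt_iff_ultrafilter.1 hQ
  have hleft : P * Q = Q := sub_eq_zero.1 <| tendsto_nhds_unique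
    ((hlim.const_mul P).sub hlim) ((tendsto_mul_cesaroAverage_sub hP).mono_left hU)
  refine ⟨hleft, Eq.trans ?_ hleft⟩
  refine tendsto_nhds_unique (hlim.mul_const P) ?_
  simpa only [(commute_cesaroAverage P _).eq] using hlim.const_mul P

theorem cesaroAverage_mul_of_mul_eq {Q : Matrix S S ℝ} (hQ : P * Q = Q) {n : ℕ} (hn : n ≠ 0) :
    cesaroAverage P n * Q = Q := by
  have hpow (i : ℕ) : P ^ i * Q = Q := by
    induction i with
    | zero => simp
    | succ i ih => rw [pow_succ, mul_assoc, hQ, ih]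
  have hn' : (n : ℝ) ≠ 0 := Nat.cast_ne_zero.2 hn
  simp [cesaroAverage, Finset.sum_mul, hpow, ← Nat.cast_smul_eq_nsmul ℝ, smul_smul, hn']

theorem mul_cesaroAverage_of_mul_eq {Q : Matrix S S ℝ} (hQ : Q * P = Q) {n : ℕ} (hn : n ≠ 0) :
    Q * cesaroAverage P n = Q := by
  have hpow (i : ℕ) : Q * P ^ i = Q := by
    induction i with
    | zero => simp
    | succ i ih => rw [pow_succ', ← mul_assoc, hQ, ih]
  have hn' : (n : ℝ) ≠ 0 := Nat.cast_ne_zero.2 hn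
  simp [cesaroAverage, Finset.mul_sum, hpow, ← Nat.cast_smul_eq_nsmul ℝ, smul_smul, hn']

theorem eq_of_mapClusterPt_cesaroAverage (hP : P ∈ Matrix.rowStochastic ℝ S)
    {Q R : Matrix S S ℝ} (hQ : MapClusterPt Q atTop (cesaroAverage P))
    (hR : MapClusterPt R atTop (cesaroAverage P)) : Q = R := by
  have hQP := (mul_eq_of_mapClusterPt_cesaroAverage hP hQ).2
  have hPR := (mul_eq_of_mapClusterPt_cesaroAverage hP hR).1
  obtain ⟨U, hU, hUlim⟩ := mapClusterPt_iff_ultrafilter.1 hQ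
  obtain ⟨V, hV, hVlim⟩ := mapClusterPt_iff_ultrafilter.1 hR
  have hQR_left : Q * R = R := by
    refine tendsto_nhds_unique (hUlim.mul_const R) (tendsto_const_nhds.congr' ?_)
    filter_upwards [hU (eventually_ne_atTop 0)] with n hn
    exact (cesaroAverage_mul_of_mul_eq hPR hn).symm
  have hQR_right : Q * R = Q := by
    refine tendsto_nhds_unique (hVlim.const_mul Q) (tendsto_const_nhds.congr' ?_)
    filter_upwards [hV (eventually_ne_atTop 0)] with n hn
    exact (mul_cesaroAverage_of_mul_eq hQP hn).symm
  exact hQR_right.symm.trans hQR_left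

/-- The Cesàro averages of a row-stochastic matrix `P` converge to a row-stochastic matrix
that is invariant under right multiplication by `P`. -/
theorem exists_tendsto_cesaroAverage (hP : P ∈ Matrix.rowStochastic ℝ S) :
    ∃ Q ∈ Matrix.rowStochastic ℝ S,
      Tendsto (cesaroAverage P) atTop (𝓝 Q) ∧ Q * P = Q := by
  have hmem : ∀ᶠ n in atTop, cesaroAverage P n ∈ (Matrix.rowStochastic ℝ S : Set _) := by
    filter_upwards [eventually_ne_atTop 0] with n hn
    exact cesaroAverage_mem_rowStochastic hP hn
  obtain ⟨Q, hQ, hQc⟩ := isCompact_rowStochastic.exists_mapClusterPt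
    (tendsto_principal.2 hmem)
  exact ⟨Q, hQ, isCompact_rowStochastic.tendsto_nhds_of_unique_mapClusterPt hmem
    fun R _ hR => eq_of_mapClusterPt_cesaroAverage hP hR hQc,
    (mul_eq_of_mapClusterPt_cesaroAverage hP hQc).2⟩

end CesaroAverage

/-- For every finite Markov chain `(S, P)` and every initial state, the Cesàro
limit `π (s) = lim_n (1/n) ∑_{i=1}^n P^i(sinit, s)` exists, is a probability
distribution on `S`, and is stationary for `P`. -/
theorem stmt2 {S : Type*} [Fintype S] [DecidableEq S] [Nonempty S]
    (P : Matrix S S ℝ) (hP : IsStochastic P) (sinit : S) :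
    ∃ π : S → ℝ,
      (∀ s : S,
        Tendsto (fun n : ℕ => (n : ℝ)⁻¹ * ∑ i ∈ Finset.Icc 1 n, (P ^ i) sinit s)
          atTop (𝓝 (π s))) ∧
      (∀ s, 0 ≤ π s) ∧ (∑ s, π s = 1) ∧ (∀ t, ∑ s, π s * P s t = π t) := by
  obtain ⟨Q, hQ, hlim, hQP⟩ :=
    exists_tendsto_cesaroAverage (Matrix.mem_rowStochastic_iff_sum.2 hP)
  refine ⟨Q sinit, fun s => ?_, fun s => Matrix.nonneg_of_mem_rowStochastic hQ,
    Matrix.sum_row_of_mem_rowStochastic hQ sinit, fun t => ?_⟩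
  · have hentry := tendsto_pi_nhds.1 (tendsto_pi_nhds.1 hlim sinit) s
    simpa only [cesaroAverage, Matrix.smul_apply, Matrix.sum_apply, smul_eq_mul] using hentry
  · rw [← Matrix.mul_apply, hQP]
end

section
/- Let (S, P) be a finite Markov chain and let R be a bottom strongly connected component of (S,P). Then for all states s₁, s₂ ∈ R: (i) π_{s₁} = π_{s₂} (the stationary distribution started inside R does not depend on the starting state within R); (ii) π_{s₁}(t) = 0 for every t ∉ R; and (iii) for every t ∈ R, π_{s₁}(t) equals the stationary distribution of the restricted Markov chain (R, P|_{R×R}) started at s₁ evaluated at t. -/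
open Finset Filter Topology

namespace IsStochastic

variable {S : Type*} [Fintype S] {P : Matrix S S ℝ}

theorem pow [DecidableEq S] (hP : IsStochastic P) (n : ℕ) : IsStochastic (P ^ n) := by
  have hmem : P ∈ Matrix.rowStochastic ℝ S := Matrix.mem_rowStochastic_iff_sum.2 hP
  exact Matrix.mem_rowStochastic_iff_sum.1 (pow_mem hmem n)

theorem le_one (hP : IsStochastic P) (s t : S) : P s t ≤ 1 :=
  hP.2 s ▸ Finset.single_le_sum (fun t _ => hP.1 s t) (Finset.mem_univ t)

/-- The Cesàro limits of the powers of `P` are harmonic in the initial state. -/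
theorem sum_mul_cesaro_limit_eq [DecidableEq S] (hP : IsStochastic P) {π : S → S → ℝ}
    (hπ : ∀ s t : S,
      Tendsto (fun n : ℕ => (n : ℝ)⁻¹ * ∑ i ∈ Finset.Icc 1 n, (P ^ i) s t)
        atTop (𝓝 (π s t))) (s t : S) :
    ∑ s', P s s' * π s' t = π s t := by
  have hlim : Tendsto (fun n : ℕ => ∑ s', P s s' *
      ((n : ℝ)⁻¹ * ∑ i ∈ Finset.Icc 1 n, (P ^ i) s' t)) atTop (𝓝 (∑ s', P s s' * π s' t)) :=
    tendsto_finsetSum _ fun s' _ => (hπ s' t).const_mul _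
  have hshift (n : ℕ) : ∑ s', P s s' * ((n : ℝ)⁻¹ * ∑ i ∈ Finset.Icc 1 n, (P ^ i) s' t) -
      (n : ℝ)⁻¹ * ∑ i ∈ Finset.Icc 1 n, (P ^ i) s t =
      ((P ^ (n + 1)) s t - P s t) * (n : ℝ)⁻¹ := by
    have hstep : ∑ s', P s s' * ((n : ℝ)⁻¹ * ∑ i ∈ Finset.Icc 1 n, (P ^ i) s' t) =
        (n : ℝ)⁻¹ * ∑ i ∈ Finset.Icc 1 n, (P ^ (i + 1)) s t := by
      simp only [pow_succ', Matrix.mul_apply, Finset.mul_sum]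
      rw [Finset.sum_comm]
      exact Finset.sum_congr rfl fun i _ => Finset.sum_congr rfl fun s' _ => by ring
    have htel : ∑ i ∈ Finset.Icc 1 n, (P ^ (i + 1)) s t - ∑ i ∈ Finset.Icc 1 n, (P ^ i) s t =
        (P ^ (n + 1)) s t - P s t := by
      clear hstep
      induction n with
      | zero => simp
      | succ n ih =>
        rw [Finset.sum_Icc_succ_top (by omega), Finset.sum_Icc_succ_top (by omega)]
        linarith
    rw [hstep, ← mul_sub, htel, mul_comm]
  have hzero : Tendsto (fun n : ℕ => ((P ^ (n + 1)) s t - P s t) * (n : ℝ)⁻¹)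
      atTop (𝓝 0) := by
    refine bdd_le_mul_tendsto_zero' 1 (Eventually.of_forall fun n => ?_)
      tendsto_inv_atTop_nhds_zero_nat
    rw [abs_le]
    constructor <;>
      linarith [(hP.pow (n + 1)).1 s t, (hP.pow (n + 1)).le_one s t, hP.1 s t, hP.le_one s t]
  refine sub_eq_zero.1 (tendsto_nhds_unique (hlim.sub (hπ s t)) ?_)
  simpa only [hshift] using hzero

/-- A harmonic function is constant on a closed strongly connected set. -/
theorem eq_of_harmonic (hP : IsStochastic P) {R : Finset S}
    (hconn : ∀ a ∈ R, ∀ b ∈ R, Relation.ReflTransGen (fun x y => 0 < P x y) a b)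
    (hclosed : ∀ s ∈ R, ∀ s' ∉ R, P s s' = 0) {h : S → ℝ}
    (hh : ∀ s, ∑ s', P s s' * h s' = h s) {a b : S} (ha : a ∈ R) (hb : b ∈ R) :
    h a = h b := by
  obtain ⟨m, hm, hmax⟩ := R.exists_max_image h ⟨a, ha⟩
  have key (c : S) (hc : Relation.ReflTransGen (fun x y => 0 < P x y) m c) :
      c ∈ R ∧ h c = h m := by
    induction hc with
    | refl => exact ⟨hm, rfl⟩
    | @tail x y _ hxy ih =>
      obtain ⟨hx, hxm⟩ := ih
      have hy : y ∈ R := by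
        by_contra hy
        exact hxy.ne' (hclosed x hx y hy)
      refine ⟨hy, ?_⟩
      have hnonneg : ∀ z ∈ Finset.univ, 0 ≤ P x z * (h m - h z) := fun z _ => by
        by_cases hz : z ∈ R
        · exact mul_nonneg (hP.1 x z) (sub_nonneg.2 (hmax z hz))
        · simp [hclosed x hx z hz]
      have hsum : ∑ z, P x z * (h m - h z) = 0 := by
        simp only [mul_sub, Finset.sum_sub_distrib, ← Finset.sum_mul, hP.2, hh, hxm, one_mul,
          sub_self]
      have hzero := (Finset.sum_eq_zero_iff_of_nonneg hnonneg).1 hsum y (Finset.mem_univ y)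
      exact (sub_eq_zero.1 ((mul_eq_zero.1 hzero).resolve_left hxy.ne')).symm
  rw [(key a (hconn m hm a ha)).2, (key b (hconn m hm b hb)).2]

end IsStochastic

section Closed

variable {S : Type*} [Fintype S] [DecidableEq S] {P : Matrix S S ℝ} {R : Finset S}

theorem pow_apply_eq_zero_of_closed (hclosed : ∀ s ∈ R, ∀ s' ∉ R, P s s' = 0) (n : ℕ)
    {s t : S} (hs : s ∈ R) (ht : t ∉ R) : (P ^ n) s t = 0 := by
  induction n generalizing s with
  | zero => exact Matrix.one_apply_ne (ne_of_mem_of_not_mem hs ht)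
  | succ n ih =>
    rw [pow_succ', Matrix.mul_apply]
    refine Finset.sum_eq_zero fun x _ => ?_
    by_cases hx : x ∈ R
    · rw [ih hx, mul_zero]
    · rw [hclosed s hs x hx, zero_mul]

theorem pow_restrict_apply_of_closed (hclosed : ∀ s ∈ R, ∀ s' ∉ R, P s s' = 0)
    {Q : Matrix {x // x ∈ R} {x // x ∈ R} ℝ} (hQ : ∀ a b, Q a b = P a.1 b.1) (n : ℕ)
    (a b : {x // x ∈ R}) : (Q ^ n) a b = (P ^ n) a.1 b.1 := by
  induction n generalizing a with
  | zero => simp only [pow_zero, Matrix.one_apply, Subtype.ext_iff]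
  | succ n ih =>
    rw [pow_succ', pow_succ', Matrix.mul_apply, Matrix.mul_apply]
    simp only [hQ, ih]
    rw [Finset.sum_coe_sort R fun x => P a.1 x * (P ^ n) x b.1]
    refine Finset.sum_subset (Finset.subset_univ R) fun x _ hx => ?_
    rw [hclosed a.1 a.2 x hx, zero_mul]

end Closed

/-- For a BSCC `R` of a finite Markov chain and `s₁, s₂ ∈ R`:
(i) the stationary distributions started at `s₁` and `s₂` coincide,
(ii) `π s₁` vanishes outside `R`, and
(iii) on `R` it agrees with the stationary distribution of the Markov chain
restricted to `R` (the matrix `Q`), started at `s₁`.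
Here `π` and `πR` are the Cesàro limits defining the respective stationary
distributions. -/
theorem stmt4 {S : Type*} [Fintype S] [DecidableEq S] [Nonempty S]
    (P : Matrix S S ℝ) (hP : IsStochastic P)
    (π : S → S → ℝ)
    (hπ : ∀ sinit s : S,
      Tendsto (fun n : ℕ => (n : ℝ)⁻¹ * ∑ i ∈ Finset.Icc 1 n, (P ^ i) sinit s)
        atTop (𝓝 (π sinit s)))
    (R : Finset S) (hR : IsBSCC P R)
    (Q : Matrix {x // x ∈ R} {x // x ∈ R} ℝ) (hQ : ∀ a b, Q a b = P a.1 b.1)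
    (πR : {x // x ∈ R} → {x // x ∈ R} → ℝ)
    (hπR : ∀ a b : {x // x ∈ R},
      Tendsto (fun n : ℕ => (n : ℝ)⁻¹ * ∑ i ∈ Finset.Icc 1 n, (Q ^ i) a b)
        atTop (𝓝 (πR a b)))
    (s₁ s₂ : S) (h₁ : s₁ ∈ R) (h₂ : s₂ ∈ R) :
    (π s₁ = π s₂) ∧
    (∀ t ∉ R, π s₁ t = 0) ∧
    (∀ (t : S) (ht : t ∈ R), π s₁ t = πR ⟨s₁, h₁⟩ ⟨t, ht⟩) := by
  obtain ⟨-, hconn, -, hclosed⟩ := hR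
  refine ⟨funext fun t => ?_, fun t ht => ?_, fun t ht => ?_⟩
  · exact hP.eq_of_harmonic hconn hclosed (h := fun s => π s t)
      (fun s => hP.sum_mul_cesaro_limit_eq hπ s t) h₁ h₂
  · refine tendsto_nhds_unique (hπ s₁ t) ?_
    simp [pow_apply_eq_zero_of_closed hclosed _ h₁ ht]
  · refine tendsto_nhds_unique (hπ s₁ t) ?_
    simpa only [pow_restrict_apply_of_closed hclosed hQ] using hπR ⟨s₁, h₁⟩ ⟨t, ht⟩
end

section
/- Let (S, P) be a finite Markov chain. For every initial state ŝ ∈ S and every state s ∈ S, the stationary distribution decomposes as π_ŝ(s) = Σ_{R ∈ BSCCs(S,P)} reach(ŝ,R) · π_R(s), where the sum ranges over all bottom strongly connected components of (S,P). -/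
open Finset Filter Topology

/-- A nonnegative row vector `w` with `w P = w`. -/
def IsInvariantVec {S : Type*} [Fintype S] (P : Matrix S S ℝ) (w : S → ℝ) : Prop :=
  (∀ s, 0 ≤ w s) ∧ ∀ t, ∑ s, w s * P s t = w t

section Invariant

variable {S : Type*} [Fintype S] {P : Matrix S S ℝ} {w : S → ℝ}

/-- Positivity of an invariant vector propagates along paths. -/
theorem IsInvariantVec.pos_of_reflTransGen (hP : IsStochastic P) (hw : IsInvariantVec P w)
    {a b : S} (hab : Relation.ReflTransGen (fun x y => 0 < P x y) a b) (ha : 0 < w a) :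
    0 < w b := by
  induction hab with
  | refl => exact ha
  | @tail b c _ hbc ih =>
    rw [← hw.2 c]
    exact (mul_pos ih hbc).trans_le (Finset.single_le_sum (f := fun s => w s * P s c)
      (fun s _ => mul_nonneg (hw.1 s) (hP.1 s c)) (Finset.mem_univ b))

theorem IsStochastic.sum_eq_one_of_closed (hP : IsStochastic P) {C : Finset S}
    (hC : ∀ s ∈ C, ∀ t ∉ C, P s t = 0) {s : S} (hs : s ∈ C) : ∑ t ∈ C, P s t = 1 := by
  rw [← hP.2 s]
  exact Finset.sum_subset (Finset.subset_univ C) fun t _ ht => hC s hs t ht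

/-- An invariant vector puts no flow into a closed set from outside. -/
theorem IsInvariantVec.mul_eq_zero_of_closed (hP : IsStochastic P) (hw : IsInvariantVec P w)
    {C : Finset S} (hC : ∀ s ∈ C, ∀ t ∉ C, P s t = 0) {s t : S} (hs : s ∉ C) (ht : t ∈ C) :
    w s * P s t = 0 := by
  classical
  have hnn : ∀ a b, 0 ≤ w a * P a b := fun a b => mul_nonneg (hw.1 a) (hP.1 a b)
  have hflow : ∑ a ∈ C, w a + ∑ a ∈ Cᶜ, ∑ b ∈ C, w a * P a b = ∑ a ∈ C, w a := by
    calc ∑ a ∈ C, w a + ∑ a ∈ Cᶜ, ∑ b ∈ C, w a * P a b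
        = ∑ a ∈ C, ∑ b ∈ C, w a * P a b + ∑ a ∈ Cᶜ, ∑ b ∈ C, w a * P a b := by
          congr 1
          refine Finset.sum_congr rfl fun a ha => ?_
          rw [← Finset.mul_sum, hP.sum_eq_one_of_closed hC ha, mul_one]
      _ = ∑ a, ∑ b ∈ C, w a * P a b := Finset.sum_add_sum_compl _ _
      _ = ∑ b ∈ C, w b := by
          rw [Finset.sum_comm]
          exact Finset.sum_congr rfl fun b _ => hw.2 b
  have hzero : ∑ a ∈ Cᶜ, ∑ b ∈ C, w a * P a b = 0 := by linarith
  have hs0 := (Finset.sum_eq_zero_iff_of_nonneg fun a _ =>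
    Finset.sum_nonneg fun b _ => hnn a b).1 hzero s (Finset.mem_compl.2 hs)
  exact (Finset.sum_eq_zero_iff_of_nonneg fun b _ => hnn s b).1 hs0 t ht

/-- The restriction of an invariant vector to a closed set is invariant. -/
theorem IsInvariantVec.indicator (hP : IsStochastic P) (hw : IsInvariantVec P w)
    {C : Finset S} (hC : ∀ s ∈ C, ∀ t ∉ C, P s t = 0) :
    IsInvariantVec P ((C : Set S).indicator w) := by
  classical
  refine ⟨fun s => Set.indicator_nonneg (fun s _ => hw.1 s) s, fun t => ?_⟩
  by_cases ht : t ∈ C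
  · rw [Set.indicator_of_mem (Finset.mem_coe.2 ht), ← hw.2 t]
    refine Finset.sum_congr rfl fun s _ => ?_
    by_cases hs : s ∈ C
    · rw [Set.indicator_of_mem (Finset.mem_coe.2 hs)]
    · rw [Set.indicator_of_notMem (mt Finset.mem_coe.1 hs), zero_mul,
        hw.mul_eq_zero_of_closed hP hC hs ht]
  · rw [Set.indicator_of_notMem (mt Finset.mem_coe.1 ht)]
    refine Finset.sum_eq_zero fun s _ => ?_
    by_cases hs : s ∈ C
    · rw [hC s hs t ht, mul_zero]
    · rw [Set.indicator_of_notMem (mt Finset.mem_coe.1 hs), zero_mul]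

open scoped Classical in
/-- The states reachable from `s`. -/
noncomputable def reachableFrom (P : Matrix S S ℝ) (s : S) : Finset S :=
  Finset.univ.filter fun t => Relation.ReflTransGen (fun x y => 0 < P x y) s t

theorem mem_reachableFrom {s t : S} :
    t ∈ reachableFrom P s ↔ Relation.ReflTransGen (fun x y => 0 < P x y) s t := by
  simp [reachableFrom]

theorem reachableFrom_closed (hP : IsStochastic P) (s : S) :
    ∀ a ∈ reachableFrom P s, ∀ b ∉ reachableFrom P s, P a b = 0 := by
  intro a ha b hb
  by_contra hab
  exact hb (mem_reachableFrom.2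
    ((mem_reachableFrom.1 ha).tail (lt_of_le_of_ne (hP.1 a b) (Ne.symm hab))))

theorem IsBSCC.eq_reachableFrom {R : Finset S} (hR : IsBSCC P R) {s : S} (hs : s ∈ R) :
    R = reachableFrom P s := by
  ext t
  rw [mem_reachableFrom]
  refine ⟨hR.2.1 s hs t, fun h => ?_⟩
  induction h with
  | refl => exact hs
  | tail _ hbc ih =>
    by_contra hc
    exact hbc.ne' (hR.2.2.2 _ ih _ hc)

/-- A state charged by an invariant vector is reachable from all its descendants. -/
theorem IsInvariantVec.reflTransGen_symm (hP : IsStochastic P) (hw : IsInvariantVec P w)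
    {s t : S} (hs : 0 < w s) (hst : Relation.ReflTransGen (fun x y => 0 < P x y) s t) :
    Relation.ReflTransGen (fun x y => 0 < P x y) t s := by
  induction hst with
  | refl => exact .refl
  | @tail b c hsb hbc ih =>
    refine Relation.ReflTransGen.trans ?_ ih
    by_contra hcb
    have h0 := hw.mul_eq_zero_of_closed hP (reachableFrom_closed hP c)
      (mt mem_reachableFrom.1 hcb) (mem_reachableFrom.2 .refl)
    exact (mul_pos (hw.pos_of_reflTransGen hP hsb hs) hbc).ne' h0

/-- The states charged by an invariant vector lie in bottom strongly connected components. -/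
theorem IsInvariantVec.isBSCC_reachableFrom (hP : IsStochastic P) (hw : IsInvariantVec P w)
    {s : S} (hs : 0 < w s) : IsBSCC P (reachableFrom P s) := by
  have hself : s ∈ reachableFrom P s := mem_reachableFrom.2 .refl
  refine ⟨⟨s, hself⟩, fun a ha b hb => ?_, fun C hC hconn => ?_, reachableFrom_closed hP s⟩
  · exact (hw.reflTransGen_symm hP hs (mem_reachableFrom.1 ha)).trans (mem_reachableFrom.1 hb)
  · exact Finset.Subset.antisymm
      (fun c hc => mem_reachableFrom.2 (hconn s (hC hself) c hc)) hC

/-- Invariant vectors are proportional on a bottom strongly connected component. -/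
theorem IsInvariantVec.eq_sum_mul (hP : IsStochastic P) (hw : IsInvariantVec P w)
    {R : Finset S} (hR : IsBSCC P R) {p : S → ℝ} (hp : IsInvariantVec P p)
    (hsum : ∑ s ∈ R, p s = 1) {s : S} (hs : s ∈ R) :
    w s = (∑ t ∈ R, w t) * p s := by
  have hpos : ∀ t ∈ R, 0 < p t := by
    obtain ⟨a, ha, hpa⟩ : ∃ a ∈ R, 0 < p a := by
      by_contra! h
      linarith [Finset.sum_nonpos h]
    exact fun t ht => hp.pos_of_reflTransGen hP (hR.2.1 a ha t ht) hpa
  obtain ⟨m, hm, hmin⟩ := Finset.exists_min_image R (fun t => w t / p t) hR.1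
  set c := w m / p m
  have hle : ∀ t ∈ R, c * p t ≤ w t := fun t ht =>
    (le_div_iff₀ (hpos t ht)).1 (hmin t ht)
  have hwR := hw.indicator hP hR.2.2.2
  have hpR := hp.indicator hP hR.2.2.2
  have hd : IsInvariantVec P fun t =>
      (R : Set S).indicator w t - c * (R : Set S).indicator p t := by
    refine ⟨fun t => ?_, fun t => ?_⟩
    · by_cases ht : t ∈ R
      · simpa [ht] using hle t ht
      · simp [ht]
    · simp only [sub_mul, Finset.sum_sub_distrib, mul_assoc, ← Finset.mul_sum, hwR.2, hpR.2]
  have heq : ∀ t ∈ R, w t = c * p t := by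
    intro t ht
    refine le_antisymm (not_lt.1 fun hlt => ?_) (hle t ht)
    have h := hd.pos_of_reflTransGen hP (hR.2.1 t ht m hm) (by simpa [ht] using hlt)
    have hmz : c * p m = w m := div_mul_cancel₀ _ (hpos m hm).ne'
    simp [hm, hmz] at h
  rw [Finset.sum_congr rfl heq, ← Finset.mul_sum, hsum, mul_one, heq s hs]

end Invariant

theorem Finset.sum_Icc_one_eq_sum_range (f : ℕ → ℝ) (n : ℕ) :
    ∑ i ∈ Finset.Icc 1 n, f i = ∑ i ∈ Finset.range n, f (i + 1) := by
  induction n with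
  | zero => simp
  | succ n ih => rw [Finset.sum_Icc_succ_top (by omega), ih, Finset.sum_range_succ]

theorem IsStochastic.pow_mem_Icc {S : Type*} [Fintype S] [DecidableEq S] {P : Matrix S S ℝ}
    (hP : IsStochastic P) (n : ℕ) (s t : S) : (P ^ n) s t ∈ Set.Icc (0 : ℝ) 1 := by
  have h := pow_mem ((Matrix.mem_rowStochastic_iff_sum (M := P)).2 hP) n
  exact ⟨Matrix.nonneg_of_mem_rowStochastic h, Matrix.le_one_of_mem_rowStochastic h⟩

/-- Cesàro limits of the rows of the powers of `P` are invariant. -/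
theorem IsStochastic.isInvariantVec_of_tendsto {S : Type*} [Fintype S] [DecidableEq S]
    {P : Matrix S S ℝ} (hP : IsStochastic P) {a : S} {μ : S → ℝ}
    (hμ : ∀ s, Tendsto (fun n : ℕ => (n : ℝ)⁻¹ * ∑ i ∈ Finset.Icc 1 n, (P ^ i) a s)
      atTop (𝓝 (μ s))) : IsInvariantVec P μ := by
  refine ⟨fun s => ge_of_tendsto' (hμ s) fun n => mul_nonneg (by positivity)
    (Finset.sum_nonneg fun i _ => (hP.pow_mem_Icc i a s).1), fun t => ?_⟩
  have hstep := tendsto_finsetSum Finset.univ fun s _ => (hμ s).mul_const (P s t)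
  have hdiff : Tendsto (fun n : ℕ => (n : ℝ)⁻¹ * ((P ^ (n + 1)) a t - (P ^ 1) a t))
      atTop (𝓝 0) := by
    refine squeeze_zero_norm (fun n => ?_) (tendsto_inv_atTop_nhds_zero_nat (𝕜 := ℝ))
    have h₁ := hP.pow_mem_Icc (n + 1) a t
    have h₂ := hP.pow_mem_Icc 1 a t
    rw [norm_mul, Real.norm_of_nonneg (by positivity : (0 : ℝ) ≤ (n : ℝ)⁻¹)]
    exact mul_le_of_le_one_right (by positivity)
      (abs_le.2 ⟨by linarith [h₁.1, h₂.2], by linarith [h₁.2, h₂.1]⟩)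
  have hlim := (hμ t).add hdiff
  rw [add_zero] at hlim
  refine tendsto_nhds_unique (hstep.congr fun n => ?_) hlim
  have htel := Finset.sum_range_sub (fun i => (P ^ (i + 1)) a t) n
  simp only [zero_add] at htel
  simp only [Finset.sum_Icc_one_eq_sum_range]
  rw [← htel, ← mul_add, ← Finset.sum_add_distrib]
  simp only [mul_assoc, ← Finset.mul_sum, Finset.sum_mul, add_sub_cancel]
  rw [Finset.sum_comm]
  simp only [pow_succ _ (_ + 1), Matrix.mul_apply]

open scoped Classical in
/-- Decomposition of the stationary distribution:
`π sinit s = ∑_{R BSCC} reach(sinit, R) · π_R(s)`.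
Here `π` is the Cesàro-limit stationary distribution, `reach sinit R` is the
limit of the probabilities `∑_{t∈R} P^n(sinit,t)` of being in `R` after `n`
steps, and `πR R` is the stationary probability vector of the chain restricted
to `R`, extended by `0` outside `R`. -/
theorem stmt6 {S : Type*} [Fintype S] [DecidableEq S] [Nonempty S]
    (P : Matrix S S ℝ) (hP : IsStochastic P)
    (π : S → S → ℝ)
    (hπ : ∀ sinit s : S,
      Tendsto (fun n : ℕ => (n : ℝ)⁻¹ * ∑ i ∈ Finset.Icc 1 n, (P ^ i) sinit s)
        atTop (𝓝 (π sinit s)))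
    (reach : S → Finset S → ℝ)
    (hreach : ∀ (s : S) (R : Finset S), IsBSCC P R →
      Tendsto (fun n : ℕ => ∑ t ∈ R, (P ^ n) s t) atTop (𝓝 (reach s R)))
    (πR : Finset S → S → ℝ)
    (hπR : ∀ R : Finset S, IsBSCC P R →
      (∀ s, 0 ≤ πR R s) ∧ (∀ s ∉ R, πR R s = 0) ∧ (∑ s ∈ R, πR R s = 1) ∧
      (∀ t ∈ R, ∑ s ∈ R, πR R s * P s t = πR R t)) :
    ∀ sinit s : S,
      π sinit s =
        ∑ R ∈ Finset.univ.filter (fun R : Finset S => IsBSCC P R),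
          reach sinit R * πR R s := by
  intro sinit s
  have hμ : IsInvariantVec P (π sinit) := hP.isInvariantVec_of_tendsto (hπ sinit)
  have hmass : ∀ R, IsBSCC P R → ∑ t ∈ R, π sinit t = reach sinit R := by
    intro R hR
    have hlim := ((tendsto_add_atTop_iff_nat 1).2 (hreach sinit R hR)).cesaro
    refine tendsto_nhds_unique ((tendsto_finsetSum R fun t _ => hπ sinit t).congr fun n => ?_) hlim
    rw [← Finset.mul_sum, Finset.sum_comm, Finset.sum_Icc_one_eq_sum_range]
  have hinv : ∀ R, IsBSCC P R → IsInvariantVec P (πR R) := by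
    intro R hR
    obtain ⟨hnn, hout, -, hstat⟩ := hπR R hR
    refine ⟨hnn, fun t => ?_⟩
    rw [← Finset.sum_subset (Finset.subset_univ R) fun a _ ha => by rw [hout a ha, zero_mul]]
    by_cases ht : t ∈ R
    · exact hstat t ht
    · rw [hout t ht]
      exact Finset.sum_eq_zero fun a ha => by rw [hR.2.2.2 a ha t ht, mul_zero]
  have hterm : ∀ R, IsBSCC P R → s ∈ R → reach sinit R * πR R s = π sinit s := by
    intro R hR hs
    rw [← hmass R hR]
    exact (hμ.eq_sum_mul hP hR (hinv R hR) (hπR R hR).2.2.1 hs).symm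
  by_cases hB : IsBSCC P (reachableFrom P s)
  · rw [Finset.sum_eq_single_of_mem (reachableFrom P s) (by simpa using hB)]
    · exact (hterm _ hB (mem_reachableFrom.2 .refl)).symm
    · intro R hR hne
      have hR' : IsBSCC P R := (Finset.mem_filter.1 hR).2
      rw [(hπR R hR').2.1 s fun hs => hne (hR'.eq_reachableFrom hs), mul_zero]
  · have hzero : π sinit s = 0 :=
      le_antisymm (not_lt.1 fun h => hB (hμ.isBSCC_reachableFrom hP h)) (hμ.1 s)
    rw [hzero, Finset.sum_eq_zero]
    intro R hR
    have hR' : IsBSCC P R := (Finset.mem_filter.1 hR).2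
    rw [(hπR R hR').2.1 s fun hs => hB (hR'.eq_reachableFrom hs ▸ hR'), mul_zero]
end

section
/- Let (S, P) be a finite Markov chain. For every state s ∈ S, the reachability probabilities of the bottom strongly connected components sum to one: Σ_{R ∈ BSCCs(S,P)} reach(s,R) = 1. -/
open Finset Filter Topology

section BSCC

variable {S : Type*} [Fintype S] {P : Matrix S S ℝ}

/-- A bottom strongly connected component is closed under reachability. -/
theorem IsBSCC.mem_of_reflTransGen {R : Finset S} (hR : IsBSCC P R) {a b : S} (ha : a ∈ R)
    (hab : Relation.ReflTransGen (fun x y => 0 < P x y) a b) : b ∈ R := by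
  induction hab with
  | refl => exact ha
  | tail _ hbc ih =>
    by_contra hc
    exact hbc.ne' (hR.2.2.2 _ ih _ hc)

theorem IsBSCC.subset_of_mem {R R' : Finset S} (hR : IsBSCC P R) (hR' : IsBSCC P R') {x : S}
    (hx : x ∈ R) (hx' : x ∈ R') : R' ⊆ R :=
  fun y hy => hR.mem_of_reflTransGen hx (hR'.2.1 x hx' y hy)

/-- Distinct bottom strongly connected components are disjoint. -/
theorem IsBSCC.disjoint {R R' : Finset S} (hR : IsBSCC P R) (hR' : IsBSCC P R') (hne : R ≠ R') :
    Disjoint R R' := by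
  rw [Finset.disjoint_left]
  intro x hx hx'
  exact hne ((hR'.subset_of_mem hR hx' hx).antisymm (hR.subset_of_mem hR' hx hx'))

open scoped Classical in
/-- Every state can reach a bottom strongly connected component. -/
theorem exists_reflTransGen_isBSCC (hP : ∀ s s', 0 ≤ P s s') (s : S) :
    ∃ t R, Relation.ReflTransGen (fun x y => 0 < P x y) s t ∧ IsBSCC P R ∧ t ∈ R := by
  let post : S → Finset S := fun a =>
    Finset.univ.filter (fun b => Relation.ReflTransGen (fun x y => 0 < P x y) a b)
  have mem_post : ∀ a b, b ∈ post a ↔ Relation.ReflTransGen (fun x y => 0 < P x y) a b := by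
    simp [post]
  obtain ⟨t, hst, hmin⟩ := Finset.exists_min_image (post s) (fun a => (post a).card)
    ⟨s, (mem_post s s).2 .refl⟩
  rw [mem_post] at hst
  have back : ∀ a ∈ post t, Relation.ReflTransGen (fun x y => 0 < P x y) a t := by
    intro a ha
    have hta := (mem_post t a).1 ha
    have hsub : post a ⊆ post t := fun b hb =>
      (mem_post t b).2 (hta.trans ((mem_post a b).1 hb))
    have heq := Finset.eq_of_subset_of_card_le hsub (hmin a ((mem_post s a).2 (hst.trans hta)))
    rw [← mem_post, heq, mem_post]
  have htt : t ∈ post t := (mem_post t t).2 .refl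
  refine ⟨t, post t, hst, ⟨⟨t, htt⟩, ?_, ?_, ?_⟩, htt⟩
  · exact fun a ha b hb => (back a ha).trans ((mem_post t b).1 hb)
  · intro C hC hconn
    exact Finset.Subset.antisymm (fun c hc => (mem_post t c).2 (hconn t (hC htt) c hc)) hC
  · intro a ha b hb
    by_contra hne
    exact hb ((mem_post t b).2 (((mem_post t a).1 ha).tail ((hP a b).lt_of_ne' hne)))

/-- Minimum principle: the states where a harmonic function attains its minimum are closed under
reachability. -/
theorem IsStochastic.eq_of_reflTransGen_of_isMin (hP : IsStochastic P) {h : S → ℝ}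
    (hh : ∀ s, h s = ∑ u, P s u * h u) {s t : S} (hmin : ∀ u, h s ≤ h u)
    (hst : Relation.ReflTransGen (fun x y => 0 < P x y) s t) : h t = h s := by
  induction hst with
  | refl => rfl
  | @tail b c _ hbc ih =>
    have hnonneg : ∀ u ∈ Finset.univ, 0 ≤ P b u * (h u - h s) := fun u _ =>
      mul_nonneg (hP.1 b u) (sub_nonneg.2 (hmin u))
    have hsum : ∑ u, P b u * (h u - h s) = 0 := by
      simp_rw [mul_sub]
      rw [Finset.sum_sub_distrib, ← hh b, ← Finset.sum_mul, hP.2 b, ih]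
      ring
    have hc := (Finset.sum_eq_zero_iff_of_nonneg hnonneg).1 hsum c (Finset.mem_univ c)
    rcases mul_eq_zero.1 hc with hc | hc
    · exact absurd hc hbc.ne'
    · linarith

variable [DecidableEq S]

theorem sum_pow_succ_apply (P : Matrix S S ℝ) (R : Finset S) (n : ℕ) (s : S) :
    ∑ t ∈ R, (P ^ (n + 1)) s t = ∑ u, P s u * ∑ t ∈ R, (P ^ n) u t := by
  simp_rw [pow_succ', Matrix.mul_apply, Finset.mul_sum]
  exact Finset.sum_comm

theorem IsStochastic.pow_s7 (hP : IsStochastic P) (n : ℕ) : IsStochastic (P ^ n) := by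
  induction n with
  | zero =>
    refine ⟨fun s s' => ?_, fun s => by simp [Matrix.one_apply]⟩
    rw [pow_zero, Matrix.one_apply]
    split_ifs <;> norm_num
  | succ n ih =>
    refine ⟨fun s s' => ?_, fun s => ?_⟩
    · rw [pow_succ', Matrix.mul_apply]
      exact Finset.sum_nonneg fun u _ => mul_nonneg (hP.1 s u) (ih.1 u s')
    · simp [sum_pow_succ_apply, ih.2, hP.2]

theorem IsBSCC.sum_pow_eq_one (hP : IsStochastic P) {R : Finset S} (hR : IsBSCC P R) (n : ℕ)
    {s : S} (hs : s ∈ R) : ∑ t ∈ R, (P ^ n) s t = 1 := by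
  induction n generalizing s with
  | zero => simp [Matrix.one_apply, hs]
  | succ n ih =>
    rw [sum_pow_succ_apply, ← hP.2 s]
    refine Finset.sum_congr rfl fun u _ => ?_
    by_cases hu : u ∈ R
    · rw [ih hu, mul_one]
    · rw [hR.2.2.2 s hs u hu, zero_mul]

end BSCC

open scoped Classical in
/-- For every state `s`, the reachability probabilities of the BSCCs sum to one,
where `reach s R = lim_n ∑_{t∈R} P^n(s,t)`. -/
theorem stmt7 {S : Type*} [Fintype S] [DecidableEq S] [Nonempty S]
    (P : Matrix S S ℝ) (hP : IsStochastic P)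
    (reach : S → Finset S → ℝ)
    (hreach : ∀ (s : S) (R : Finset S), IsBSCC P R →
      Tendsto (fun n : ℕ => ∑ t ∈ R, (P ^ n) s t) atTop (𝓝 (reach s R))) :
    ∀ s : S,
      ∑ R ∈ Finset.univ.filter (fun R : Finset S => IsBSCC P R), reach s R = 1 := by
  have hmem : ∀ R ∈ Finset.univ.filter (fun R : Finset S => IsBSCC P R), IsBSCC P R :=
    fun R hR => (Finset.mem_filter.1 hR).2
  set h : S → ℝ := fun s =>
    ∑ R ∈ Finset.univ.filter (fun R : Finset S => IsBSCC P R), reach s R with h_def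
  have h_harmonic : ∀ s, h s = ∑ u, P s u * h u := by
    intro s
    simp_rw [h_def, Finset.mul_sum]
    rw [Finset.sum_comm]
    refine Finset.sum_congr rfl fun R hR => ?_
    refine tendsto_nhds_unique ((tendsto_add_atTop_iff_nat 1).2 (hreach s R (hmem R hR))) ?_
    simp_rw [sum_pow_succ_apply]
    exact tendsto_finsetSum _ fun u _ => (hreach u R (hmem R hR)).const_mul (P s u)
  have h_le : ∀ s, h s ≤ 1 := by
    intro s
    refine le_of_tendsto' (tendsto_finsetSum _ fun R hR => hreach s R (hmem R hR)) fun n => ?_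
    rw [← Finset.sum_biUnion fun R hR R' hR' hne => (hmem R hR).disjoint (hmem R' hR') hne,
      ← (hP.pow_s7 n).2 s]
    exact Finset.sum_le_sum_of_subset_of_nonneg (Finset.subset_univ _)
      fun t _ _ => (hP.pow_s7 n).1 s t
  have h_ge : ∀ R, IsBSCC P R → ∀ t ∈ R, 1 ≤ h t := by
    intro R hR t ht
    have hone : reach t R = 1 := by
      refine tendsto_nhds_unique (hreach t R hR) ?_
      simp_rw [hR.sum_pow_eq_one hP _ ht]
      exact tendsto_const_nhds
    rw [← hone]
    exact Finset.single_le_sum (f := reach t) (fun R' hR' =>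
      ge_of_tendsto' (hreach t R' (hmem R' hR'))
        fun n => Finset.sum_nonneg fun u _ => (hP.pow_s7 n).1 t u)
      (Finset.mem_filter.2 ⟨Finset.mem_univ R, hR⟩)
  intro s
  obtain ⟨m, hm⟩ := Finite.exists_min h
  obtain ⟨t, R, hmt, hR, ht⟩ := exists_reflTransGen_isBSCC hP.1 m
  have hmin := hP.eq_of_reflTransGen_of_isMin h_harmonic hm hmt
  exact le_antisymm (h_le s) (((h_ge R hR t ht).trans_eq hmin).trans (hm s))
end

section
/- Let (S, P) be a finite Markov chain whose transition graph is strongly connected (so S itself is the unique bottom strongly connected component), and let π be its unique stationary probability vector. Fix a state s ∈ S and let r = 1_{{s}} be the indicator reward (r(s) = 1 and r(t) = 0 for t ≠ s). Then for every state s' ∈ S, the expected mean payoff from s' equals π(s): E_{ℙ_{s'}}[ liminf_{n→∞} (1/n) Σ_{i=1}^n r(ω(i)) ] = π(s). In particular this value is the same for all starting states s'. -/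
open Finset Filter Topology MeasureTheory

/-- A function harmonic for an irreducible stochastic matrix is constant. -/
lemma IsStochastic.eq_of_harmonic_s9 {S : Type*} [Fintype S] [Nonempty S] {P : Matrix S S ℝ}
    (hP : IsStochastic P)
    (hirr : ∀ a b : S, Relation.ReflTransGen (fun x y => 0 < P x y) a b)
    {h : S → ℝ} (hh : ∀ x, ∑ y, P x y * h y = h x) (a b : S) : h a = h b := by
  obtain ⟨m, hm⟩ := Finite.exists_max h
  have step : ∀ x y, 0 < P x y → h x = h m → h y = h m := by
    intro x y hxy hx
    have hsum : ∑ z, P x z * (h m - h z) = 0 := by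
      simp only [mul_sub, Finset.sum_sub_distrib, ← Finset.sum_mul, hP.2, hh, hx]
      ring
    have hz := (Finset.sum_eq_zero_iff_of_nonneg
      (fun z _ => mul_nonneg (hP.1 x z) (sub_nonneg.2 (hm z)))).1 hsum y (Finset.mem_univ y)
    rcases mul_eq_zero.1 hz with h0 | h0
    · exact absurd h0 hxy.ne'
    · linarith
  have all : ∀ y, h y = h m := by
    intro y
    induction hirr m y with
    | refl => rfl
    | tail _ hxy ih => exact step _ _ hxy ih
  rw [all a, all b]

/-- The Poisson equation of an irreducible finite Markov chain is solvable for every right-hand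
side with mean zero under the stationary vector. -/
lemma IsStochastic.exists_poisson {S : Type*} [Fintype S] [Nonempty S]
    {P : Matrix S S ℝ} (hP : IsStochastic P)
    (hirr : ∀ a b : S, Relation.ReflTransGen (fun x y => 0 < P x y) a b)
    {π : S → ℝ} (hπ1 : ∑ s, π s = 1) (hπstat : ∀ t, ∑ s, π s * P s t = π t)
    {f : S → ℝ} (hf : ∑ x, π x * f x = 0) :
    ∃ g : S → ℝ, ∀ x, g x - ∑ y, P x y * g y = f x := by
  let L : (S → ℝ) →ₗ[ℝ] (S → ℝ) := LinearMap.id - P.mulVecLin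
  have hL : ∀ g x, L g x = g x - ∑ y, P x y * g y := fun g x => rfl
  let φ : (S → ℝ) →ₗ[ℝ] ℝ := ∑ x, π x • LinearMap.proj x
  have hφ : ∀ g, φ g = ∑ x, π x * g x := fun g => by simp [φ]
  have hle : LinearMap.range L ≤ LinearMap.ker φ := by
    rintro _ ⟨g, rfl⟩
    have hswap : ∑ x, π x * ∑ y, P x y * g y = ∑ y, π y * g y := by
      simp only [Finset.mul_sum]
      rw [Finset.sum_comm]
      simp only [← mul_assoc, ← Finset.sum_mul, hπstat]
    simp only [LinearMap.mem_ker, hφ, hL, mul_sub, Finset.sum_sub_distrib, hswap, sub_self]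
  have hker : Module.finrank ℝ (LinearMap.ker L) ≤ 1 := by
    refine (Submodule.finrank_mono (t := Submodule.span ℝ {fun _ => (1 : ℝ)}) ?_).trans
      ((finrank_span_le_card _).trans (by simp))
    intro h hh
    have hharm : ∀ x, ∑ y, P x y * h y = h x := fun x => by
      have := congrFun (LinearMap.mem_ker.1 hh) x
      rw [hL, Pi.zero_apply] at this
      linarith
    refine Submodule.mem_span_singleton.2 ⟨h (Classical.arbitrary S), ?_⟩
    ext x
    simpa using hP.eq_of_harmonic_s9 hirr hharm _ x
  have hφsurj : LinearMap.range φ = ⊤ := by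
    refine LinearMap.range_eq_top.2 fun c => ⟨fun _ => c, ?_⟩
    rw [hφ, ← Finset.sum_mul, hπ1, one_mul]
  have h1 := L.finrank_range_add_finrank_ker
  have h2 := φ.finrank_range_add_finrank_ker
  rw [hφsurj, finrank_top, Module.finrank_self] at h2
  have heq := Submodule.eq_of_le_of_finrank_le hle (by omega)
  have hmem : f ∈ LinearMap.range L := heq ▸ (LinearMap.mem_ker.2 ((hφ f).trans hf))
  obtain ⟨g, hg⟩ := hmem
  exact ⟨g, fun x => by rw [← hL, hg]⟩

section Trajectory

variable {S : Type*} [Fintype S] [MeasurableSpace S] [MeasurableSingletonClass S]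

/-- If the cylinder probabilities of `μ` are the products of the transition probabilities `P`,
then `g (ω (n + 1))` minus its conditional mean is orthogonal to every function of the first
`n + 1` coordinates. -/
lemma integral_mul_martingale_difference_eq_zero {P : Matrix S S ℝ} (hP : IsStochastic P)
    {μ : Measure (ℕ → S)} [IsProbabilityMeasure μ] {c : S → ENNReal}
    (hcyl : ∀ (n : ℕ) (w : ℕ → S), μ {ω | ∀ i ≤ n, ω i = w i} =
      c (w 0) * ∏ i ∈ Finset.range n, ENNReal.ofReal (P (w i) (w (i + 1))))
    (g : S → ℝ) (n : ℕ) {F : (ℕ → S) → ℝ}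
    (hF : ∀ ω ω' : ℕ → S, (∀ i ≤ n, ω i = ω' i) → F ω = F ω') :
    ∫ ω, F ω * (g (ω (n + 1)) - ∑ t, P (ω n) t * g t) ∂μ = 0 := by
  let φ : (ℕ → S) → (Fin (n + 1) → S) × S := fun ω => (fun i => ω i, ω (n + 1))
  let e : (Fin (n + 1) → S) → S → ℕ → S := fun v t i => if h : i < n + 1 then v ⟨i, h⟩ else t
  have he : ∀ v t i, i ≤ n → ∀ t', e v t i = e v t' i := fun v t i hi t' => by
    simp only [e, dif_pos (Nat.lt_succ_of_le hi)]
  have he' : ∀ v t, e v t (n + 1) = t := fun v t => by simp [e]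
  have hφ : Measurable φ := by fun_prop
  let K : (Fin (n + 1) → S) × S → ℝ := fun p =>
    F (e p.1 p.2) * (g p.2 - ∑ t, P (p.1 (Fin.last n)) t * g t)
  have hK : ∀ ω, F ω * (g (ω (n + 1)) - ∑ t, P (ω n) t * g t) = K (φ ω) := by
    intro ω
    have : F ω = F (e (fun i => ω i) (ω (n + 1))) :=
      hF _ _ fun i hi => by simp only [e, dif_pos (Nat.lt_succ_of_le hi)]
    simp [K, φ, ← this]
  have hpre : ∀ v t, φ ⁻¹' {(v, t)} = {ω | ∀ i ≤ n + 1, ω i = e v t i} := by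
    intro v t
    ext ω
    simp only [φ, Set.mem_preimage, Set.mem_singleton_iff, Prod.mk.injEq, Set.mem_ofPred_eq]
    constructor
    · rintro ⟨rfl, rfl⟩ i hi
      by_cases h : i < n + 1
      · simp only [e, dif_pos h]
      · obtain rfl : i = n + 1 := by omega
        exact (he' (fun j => ω j) (ω (n + 1))).symm
    · intro h
      refine ⟨funext fun i => ?_, by rw [h _ le_rfl, he']⟩
      rw [h i (by omega)]
      simp only [e, dif_pos i.2]
  have hμ : ∀ v t t', (μ.map φ).real {(v, t)} =
      μ.real {ω | ∀ i ≤ n, ω i = e v t' i} * P (v (Fin.last n)) t := by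
    intro v t t'
    have hlast : e v t n = v (Fin.last n) := by simp [e, Fin.last]
    have h1 := hcyl (n + 1) (e v t)
    rw [Finset.prod_range_succ, ← mul_assoc, ← hcyl n (e v t), he', hlast] at h1
    rw [map_measureReal_apply hφ (measurableSet_singleton _), hpre, measureReal_def, h1,
      ENNReal.toReal_mul, ENNReal.toReal_ofReal (hP.1 _ _), measureReal_def]
    congr 3
    ext ω
    exact forall₂_congr fun i hi => by rw [he v t i hi t']
  simp only [hK]
  have : IsProbabilityMeasure (μ.map φ) := Measure.isProbabilityMeasure_map hφ.aemeasurable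
  rw [← integral_map hφ.aemeasurable (Measurable.of_discrete (f := K)).aestronglyMeasurable,
    integral_fintype Integrable.of_finite, Fintype.sum_prod_type]
  refine Finset.sum_eq_zero fun v _ => ?_
  have hFv : ∀ t, F (e v t) = F (e v (v 0)) := fun t => hF _ _ fun i hi => he v t i hi _
  simp only [K, hμ v _ (v 0), hFv, smul_eq_mul]
  set m := μ.real {ω | ∀ i ≤ n, ω i = e v (v 0) i}
  set A := ∑ t, P (v (Fin.last n)) t * g t with hA
  have : ∀ t, m * P (v (Fin.last n)) t * (F (e v (v 0)) * (g t - A)) =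
      m * F (e v (v 0)) * (P (v (Fin.last n)) t * g t - P (v (Fin.last n)) t * A) := fun t => by
    ring
  simp only [this, ← Finset.mul_sum, Finset.sum_sub_distrib, ← Finset.sum_mul, hP.2, ← hA]
  ring

/-- The second moment of the sum of the first `n` martingale differences grows at most
linearly. -/
lemma integral_sq_sum_martingale_difference_le {P : Matrix S S ℝ} (hP : IsStochastic P)
    {μ : Measure (ℕ → S)} [IsProbabilityMeasure μ] {c : S → ENNReal}
    (hcyl : ∀ (n : ℕ) (w : ℕ → S), μ {ω | ∀ i ≤ n, ω i = w i} =
      c (w 0) * ∏ i ∈ Finset.range n, ENNReal.ofReal (P (w i) (w (i + 1))))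
    (g : S → ℝ) {C : ℝ} (hC : ∀ x y, |g y - ∑ t, P x t * g t| ≤ C) (n : ℕ) :
    Integrable (fun ω : ℕ → S =>
      (∑ i ∈ Finset.range n, (g (ω (i + 1)) - ∑ t, P (ω i) t * g t)) ^ 2) μ ∧
    ∫ ω, (∑ i ∈ Finset.range n, (g (ω (i + 1)) - ∑ t, P (ω i) t * g t)) ^ 2 ∂μ ≤ C ^ 2 * n := by
  let D : ℕ → (ℕ → S) → ℝ := fun i ω => g (ω (i + 1)) - ∑ t, P (ω i) t * g t
  let M : ℕ → (ℕ → S) → ℝ := fun n ω => ∑ i ∈ Finset.range n, D i ω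
  have hDm : ∀ i, Measurable (D i) := fun i =>
    ((Measurable.of_discrete (f := g)).comp (measurable_pi_apply _)).sub
      ((Measurable.of_discrete (f := fun x => ∑ t, P x t * g t)).comp (measurable_pi_apply _))
  have hMm : ∀ n, Measurable (M n) := fun n => Finset.measurable_fun_sum _ fun i _ => hDm i
  have hDb : ∀ i ω, |D i ω| ≤ C := fun i ω => hC _ _
  have hMb : ∀ n ω, |M n ω| ≤ n * C := fun n ω =>
    (Finset.abs_sum_le_sum_abs _ _).trans
      ((Finset.sum_le_sum fun i _ => hDb i ω).trans (by simp))
  have hD : ∀ i, MemLp (D i) 2 μ := fun i =>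
    MemLp.of_bound (hDm i).aestronglyMeasurable C (ae_of_all _ (hDb i))
  have hM : ∀ n, MemLp (M n) 2 μ := fun n =>
    MemLp.of_bound (hMm n).aestronglyMeasurable (n * C) (ae_of_all _ (hMb n))
  refine ⟨(hM n).integrable_sq, ?_⟩
  change ∫ ω, M n ω ^ 2 ∂μ ≤ _
  induction n with
  | zero => simp [M]
  | succ n ih =>
    have hexp : ∀ ω, M (n + 1) ω ^ 2 = M n ω ^ 2 + 2 * (M n ω * D n ω) + D n ω ^ 2 := fun ω => by
      have : M (n + 1) ω = M n ω + D n ω := Finset.sum_range_succ _ _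
      rw [this]; ring
    have hMD : Integrable (fun ω => M n ω * D n ω) μ := (hM n).integrable_mul (hD n)
    have horth : ∫ ω, M n ω * D n ω ∂μ = 0 :=
      integral_mul_martingale_difference_eq_zero hP hcyl g n fun ω ω' h =>
        Finset.sum_congr rfl fun i hi => by
          have hi := Finset.mem_range.1 hi
          simp only [D, h i hi.le, h (i + 1) hi]
    have hDsq : ∫ ω, D n ω ^ 2 ∂μ ≤ C ^ 2 := by
      refine (integral_mono (hD n).integrable_sq (integrable_const (C ^ 2)) fun ω => ?_).trans
        (by simp)
      exact sq_le_sq' (abs_le.1 (hDb n ω)).1 (abs_le.1 (hDb n ω)).2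
    simp only [hexp]
    rw [integral_add (by exact (hM n).integrable_sq.add (hMD.const_mul 2)) (hD n).integrable_sq,
      integral_add (hM n).integrable_sq (hMD.const_mul 2), integral_const_mul, horth]
    push_cast
    linarith

end Trajectory

/-- Real random variables whose second moments are summable tend to zero almost surely. -/
lemma ae_tendsto_zero_of_summable_integral_sq {Ω : Type*} [MeasurableSpace Ω] {μ : Measure Ω}
    {X : ℕ → Ω → ℝ} (hX : ∀ k, Integrable (fun ω => X k ω ^ 2) μ) {b : ℕ → ℝ}
    (hb : Summable b) (hXb : ∀ k, ∫ ω, X k ω ^ 2 ∂μ ≤ b k) :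
    ∀ᵐ ω ∂μ, Tendsto (fun k => X k ω) atTop (𝓝 0) := by
  have hm : ∀ k, AEMeasurable (fun ω => ENNReal.ofReal (X k ω ^ 2)) μ := fun k =>
    (hX k).aemeasurable.ennreal_ofReal
  have hfin : ∫⁻ ω, ∑' k, ENNReal.ofReal (X k ω ^ 2) ∂μ ≠ ⊤ := by
    rw [lintegral_tsum hm]
    refine ne_top_of_le_ne_top hb.tsum_ofReal_ne_top (ENNReal.tsum_le_tsum fun k => ?_)
    rw [← ofReal_integral_eq_lintegral_ofReal (hX k) (ae_of_all _ fun ω => sq_nonneg _)]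
    exact ENNReal.ofReal_le_ofReal (hXb k)
  filter_upwards [ae_lt_top' (AEMeasurable.tsum hm) hfin] with ω hω
  have h0 := ENNReal.tendsto_atTop_zero_of_tsum_ne_top hω.ne
  have h1 : Tendsto (fun k => X k ω ^ 2) atTop (𝓝 0) := by
    simpa [Function.comp_def, ENNReal.toReal_ofReal, sq_nonneg] using
      (ENNReal.tendsto_toReal ENNReal.zero_ne_top).comp h0
  have h2 := h1.sqrt
  simp only [Real.sqrt_sq_eq_abs, Real.sqrt_zero] at h2
  exact (tendsto_zero_iff_abs_tendsto_zero _).2 h2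

/-- For a strongly connected finite Markov chain with stationary probability
vector `π`, and the indicator reward `r = 1_{{s}}`, the expected mean payoff
from every state `s'` equals `π s`:
`E_{ℙ_{s'}}[liminf_n (1/n) ∑_{i=1}^n r(ω i)] = π s`.
The measure `μ s'` is the canonical trajectory measure started at `s'`,
characterized by its values on cylinder sets. -/
theorem stmt9 {S : Type*} [Fintype S] [DecidableEq S] [Nonempty S]
    [MeasurableSpace S] [MeasurableSingletonClass S]
    (P : Matrix S S ℝ) (hP : IsStochastic P)
    (hirr : ∀ a b : S, Relation.ReflTransGen (fun x y => 0 < P x y) a b)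
    (μ : S → Measure (ℕ → S)) (hμ : ∀ s, IsProbabilityMeasure (μ s))
    (hcyl : ∀ (s : S) (n : ℕ) (w : ℕ → S),
      μ s {ω | ∀ i ≤ n, ω i = w i} =
        (if w 0 = s then 1 else 0) *
          ∏ i ∈ Finset.range n, ENNReal.ofReal (P (w i) (w (i + 1))))
    (π : S → ℝ) (hπ0 : ∀ s, 0 ≤ π s) (hπ1 : ∑ s, π s = 1)
    (hπstat : ∀ t, ∑ s, π s * P s t = π t)
    (s : S) :
    ∀ s' : S,
      ∫ ω, liminf
          (fun n : ℕ => (n : ℝ)⁻¹ * ∑ i ∈ Finset.Icc 1 n, (if ω i = s then (1 : ℝ) else 0))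
          atTop ∂(μ s')
        = π s := by
  intro s'
  have := hμ s'
  let f : S → ℝ := fun x => (if x = s then 1 else 0) - π s
  obtain ⟨g, hg⟩ : ∃ g : S → ℝ, ∀ x, g x - ∑ y, P x y * g y = f x := by
    refine hP.exists_poisson hirr hπ1 hπstat ?_
    simp [f, mul_sub, Finset.sum_sub_distrib, ← Finset.sum_mul, hπ1]
  let Pg : S → ℝ := fun x => ∑ y, P x y * g y
  let D : ℕ → (ℕ → S) → ℝ := fun i ω => g (ω (i + 1)) - Pg (ω i)
  let u : (ℕ → S) → ℕ → ℝ := fun ω n => ∑ i ∈ Finset.Icc 1 n, if ω i = s then (1 : ℝ) else 0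
  have hu : ∀ ω n, u ω n = n * π s + (∑ i ∈ Finset.range n, D i ω) + (Pg (ω 0) - Pg (ω n)) := by
    intro ω n
    induction n with
    | zero => simp [u]
    | succ n ih =>
      have h1 : u ω (n + 1) = u ω n + if ω (n + 1) = s then (1 : ℝ) else 0 :=
        Finset.sum_Icc_succ_top (by omega) _
      have h2 : g (ω (n + 1)) - Pg (ω (n + 1)) = (if ω (n + 1) = s then 1 else 0) - π s :=
        hg (ω (n + 1))
      rw [h1, ih, Finset.sum_range_succ]
      simp only [D]
      push_cast
      linarith
  obtain ⟨p, hp⟩ := Finite.exists_max fun p : S × S => |g p.2 - Pg p.1|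
  obtain ⟨q, hq⟩ := Finite.exists_max fun q : S × S => |Pg q.1 - Pg q.2|
  set C := |g p.2 - Pg p.1|
  set B := |Pg q.1 - Pg q.2|
  have hsecond := integral_sq_sum_martingale_difference_le hP (μ := μ s')
    (c := fun x => if x = s' then 1 else 0) (hcyl s') g (C := C) (fun x y => hp (x, y))
  have hae : ∀ᵐ ω ∂(μ s'), Tendsto
      (fun k : ℕ => (∑ i ∈ Finset.range ((k + 1) ^ 2), D i ω) / ((k + 1 : ℝ) ^ 2))
      atTop (𝓝 0) := by
    refine ae_tendsto_zero_of_summable_integral_sq (b := fun k => C ^ 2 * (1 / (k + 1 : ℝ) ^ 2))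
      (fun k => ?_) ?_ fun k => ?_
    · simp only [div_pow]
      exact (hsecond _).1.div_const _
    · have := (summable_nat_add_iff 1).2 (Real.summable_one_div_nat_pow.2 one_lt_two)
      exact Summable.mul_left _ (by simpa using this)
    · simp only [div_pow]
      rw [integral_div, div_le_iff₀ (by positivity)]
      refine (hsecond _).2.trans_eq ?_
      push_cast
      field_simp
  have hconv : ∀ᵐ ω ∂(μ s'), Tendsto (fun n : ℕ => u ω n / n) atTop (𝓝 (π s)) := by
    filter_upwards [hae] with ω hω
    have hmono : Monotone (u ω) := fun m n hmn =>
      Finset.sum_le_sum_of_subset_of_nonneg (Finset.Icc_subset_Icc_right hmn)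
        fun i _ _ => by split_ifs <;> norm_num
    have hsq : Tendsto (fun k : ℕ => (k + 1 : ℝ) ^ 2) atTop atTop :=
      (tendsto_pow_atTop two_ne_zero).comp
        (tendsto_atTop_add_const_right _ 1 tendsto_natCast_atTop_atTop)
    have hbd : Tendsto (fun k : ℕ => (Pg (ω 0) - Pg (ω ((k + 1) ^ 2))) / ((k + 1 : ℝ) ^ 2))
        atTop (𝓝 0) := by
      refine squeeze_zero_norm (fun k => ?_) (hsq.const_div_atTop B)
      rw [norm_div, Real.norm_eq_abs, Real.norm_of_nonneg (by positivity)]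
      gcongr
      exact hq (ω 0, ω ((k + 1) ^ 2))
    refine tendsto_div_of_monotone_of_exists_subseq_tendsto_div _ _ hmono fun a ha =>
      ⟨fun k => (k + 1) ^ 2, ?_, ?_, ?_⟩
    · have hratio : Tendsto (fun k : ℕ => (1 + 1 / ((k : ℝ) + 1)) ^ 2) atTop (𝓝 1) := by
        simpa using (tendsto_one_div_add_atTop_nhds_zero_nat (𝕜 := ℝ)).const_add 1 |>.pow 2
      filter_upwards [hratio.eventually (gt_mem_nhds ha)] with k hk
      have hpos : (0 : ℝ) < k + 1 := by positivity
      calc (((k + 1 + 1) ^ 2 : ℕ) : ℝ) = (1 + 1 / ((k : ℝ) + 1)) ^ 2 * (k + 1) ^ 2 := by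
            push_cast; field_simp
        _ ≤ a * (k + 1) ^ 2 := by gcongr
        _ = a * ((k + 1) ^ 2 : ℕ) := by push_cast; ring
    · exact tendsto_natCast_atTop_iff.1 (by simpa using hsq)
    · have := (hω.add hbd).const_add (π s)
      simp only [add_zero] at this
      refine this.congr fun k => ?_
      rw [hu]
      have hpos : (0 : ℝ) < k + 1 := by positivity
      push_cast
      field_simp
      ring
  have hlim : ∀ᵐ ω ∂(μ s'), liminf (fun n : ℕ => (n : ℝ)⁻¹ * u ω n) atTop = π s := by
    filter_upwards [hconv] with ω hω
    refine Tendsto.liminf_eq (hω.congr fun n => ?_)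
    rw [div_eq_inv_mul]
  rw [integral_congr_ae hlim]
  simp
end

section
/- Let (S, P) be a finite Markov chain whose transition graph is strongly connected and such that every state is aperiodic, and let π be the unique stationary probability vector of P. Then the powers of P converge: for all states s, t ∈ S, lim_{n→∞} P^n(s,t) = π(t). Consequently, for every probability vector v₀ on S, the power-method iterates v_n = v₀ P^n converge to π. -/
open Finset Filter Topology

open Matrix in
theorem Matrix.pow_add_apply_pos {S : Type*} [Fintype S] [DecidableEq S] {P : Matrix S S ℝ}
    (hP : P ∈ rowStochastic ℝ S) {a b c : S} {m n : ℕ}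
    (hm : 0 < (P ^ m) a b) (hn : 0 < (P ^ n) b c) : 0 < (P ^ (m + n)) a c := by
  rw [pow_add, Matrix.mul_apply]
  exact Finset.sum_pos' (fun i _ => mul_nonneg ((pow_mem hP m).1 _ _) ((pow_mem hP n).1 _ _))
    ⟨b, Finset.mem_univ b, mul_pos hm hn⟩

open Matrix in
theorem Matrix.exists_pow_apply_pos_of_reflTransGen {S : Type*} [Fintype S] [DecidableEq S]
    {P : Matrix S S ℝ} (hP : P ∈ rowStochastic ℝ S) {a b : S}
    (h : Relation.ReflTransGen (fun x y => 0 < P x y) a b) : ∃ k, 0 < (P ^ k) a b := by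
  induction h with
  | refl => exact ⟨0, by simp⟩
  | tail _ hbc ih =>
    obtain ⟨k, hk⟩ := ih
    exact ⟨k + 1, Matrix.pow_add_apply_pos hP hk (by simpa using hbc)⟩

open Matrix in
/-- An aperiodic state returns to itself with positive probability at all large times. -/
theorem Matrix.eventually_pow_apply_self_pos {S : Type*} [Fintype S] [DecidableEq S]
    {P : Matrix S S ℝ} (hP : P ∈ rowStochastic ℝ S) (s : S)
    (haper : ∀ d : ℕ, (∀ n : ℕ, 0 < n → 0 < (P ^ n) s s → d ∣ n) → d = 1) :
    ∀ᶠ n in atTop, 0 < (P ^ n) s s := by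
  let A : AddSubmonoid ℕ :=
    { carrier := {n | 0 < (P ^ n) s s}
      zero_mem' := by simp
      add_mem' := fun hm hn => Matrix.pow_add_apply_pos hP hm hn }
  have hgcd : Nat.setGcd (A : Set ℕ) = 1 :=
    haper _ fun n _ hn => Nat.setGcd_dvd_of_mem hn
  obtain ⟨N, hN⟩ := Nat.exists_mem_closure_of_ge (A : Set ℕ)
  filter_upwards [eventually_ge_atTop N] with n hn
  have hmem := hN n hn (by simp [hgcd])
  rwa [AddSubmonoid.closure_eq] at hmem

open Matrix in
/-- An irreducible aperiodic stochastic matrix is primitive. -/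
theorem Matrix.eventually_pow_pos {S : Type*} [Fintype S] [DecidableEq S]
    {P : Matrix S S ℝ} (hP : P ∈ rowStochastic ℝ S)
    (hirr : ∀ a b : S, Relation.ReflTransGen (fun x y => 0 < P x y) a b)
    (haper : ∀ s : S, ∀ d : ℕ, (∀ n : ℕ, 0 < n → 0 < (P ^ n) s s → d ∣ n) → d = 1) :
    ∀ᶠ n in atTop, ∀ s t, 0 < (P ^ n) s t := by
  simp only [Filter.eventually_all]
  intro s t
  obtain ⟨k, hk⟩ := Matrix.exists_pow_apply_pos_of_reflTransGen hP (hirr s t)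
  obtain ⟨N, hN⟩ := eventually_atTop.1 (Matrix.eventually_pow_apply_self_pos hP s (haper s))
  filter_upwards [eventually_ge_atTop (N + k)] with n hn
  have h := Matrix.pow_add_apply_pos hP (hN (n - k) (by omega)) hk
  rwa [Nat.sub_add_cancel (by omega)] at h

open Matrix in
theorem Matrix.sum_abs_vecMul_le {S : Type*} [Fintype S] {R : Matrix S S ℝ} {r : ℝ}
    (hR : ∀ s t, 0 ≤ R s t) (hr : ∀ s, ∑ t, R s t = r) (u : S → ℝ) :
    ∑ t, |(u ᵥ* R) t| ≤ r * ∑ s, |u s| := by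
  calc ∑ t, |(u ᵥ* R) t| ≤ ∑ t, ∑ s, |u s| * R s t := by
        refine Finset.sum_le_sum fun t _ => (Finset.abs_sum_le_sum_abs _ _).trans_eq ?_
        exact Finset.sum_congr rfl fun s _ => by rw [abs_mul, abs_of_nonneg (hR s t)]
    _ = r * ∑ s, |u s| := by
        rw [Finset.sum_comm, Finset.mul_sum]
        exact Finset.sum_congr rfl fun s _ => by rw [← Finset.mul_sum, hr, mul_comm]

open Matrix in
theorem Matrix.sum_vecMul_of_mem_rowStochastic {S : Type*} [Fintype S] [DecidableEq S]
    {Q : Matrix S S ℝ} (hQ : Q ∈ rowStochastic ℝ S) (u : S → ℝ) :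
    ∑ t, (u ᵥ* Q) t = ∑ s, u s := by
  rw [← dotProduct_one, ← dotProduct_mulVec, hQ.2, dotProduct_one]

open Matrix in
/-- Doeblin contraction: a positive stochastic matrix strictly contracts the `ℓ¹` norm on
vectors of total mass zero. -/
theorem Matrix.exists_sum_abs_vecMul_le {S : Type*} [Fintype S] [DecidableEq S] [Nonempty S]
    {Q : Matrix S S ℝ} (hQ : Q ∈ rowStochastic ℝ S) (hpos : ∀ s t, 0 < Q s t) :
    ∃ r : ℝ, 0 ≤ r ∧ r < 1 ∧ ∀ u : S → ℝ, ∑ s, u s = 0 →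
      ∑ t, |(u ᵥ* Q) t| ≤ r * ∑ s, |u s| := by
  obtain ⟨⟨a, b⟩, hab⟩ := Finite.exists_min (fun p : S × S => Q p.1 p.2)
  let δ := Q a b
  have hR : ∀ s t, 0 ≤ (Matrix.of fun s t => Q s t - δ) s t := fun s t => by
    simpa using hab (s, t)
  have hr : ∀ s, ∑ t, (Matrix.of fun s t => Q s t - δ) s t = 1 - Fintype.card S * δ := fun s => by
    simp [Finset.sum_sub_distrib, sum_row_of_mem_rowStochastic hQ]
  refine ⟨1 - Fintype.card S * δ, ?_, ?_, fun u hu => ?_⟩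
  · rw [← hr a]
    exact Finset.sum_nonneg fun t _ => hR a t
  · have : 0 < (Fintype.card S : ℝ) * δ :=
      mul_pos (by exact_mod_cast Fintype.card_pos) (hpos a b)
    linarith
  · have hQR : u ᵥ* Q = u ᵥ* (Matrix.of fun s t => Q s t - δ) := by
      ext t
      simp [vecMul, dotProduct, mul_sub, Finset.sum_sub_distrib, ← Finset.sum_mul, hu]
    rw [hQR]
    exact Matrix.sum_abs_vecMul_le hR hr u

open Matrix in
theorem Matrix.tendsto_vecMul_pow_zero {S : Type*} [Fintype S] [DecidableEq S] [Nonempty S]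
    {P : Matrix S S ℝ} (hP : P ∈ rowStochastic ℝ S)
    {N : ℕ} (hN : N ≠ 0) (hpos : ∀ s t, 0 < (P ^ N) s t) (u : S → ℝ) (hu : ∑ s, u s = 0) (t : S) :
    Tendsto (fun n : ℕ => (u ᵥ* P ^ n) t) atTop (𝓝 0) := by
  obtain ⟨r, hr0, hr1, hr⟩ := Matrix.exists_sum_abs_vecMul_le (pow_mem hP N) hpos
  have hgeom : ∀ k : ℕ, ∑ t, |(u ᵥ* (P ^ N) ^ k) t| ≤ r ^ k * ∑ s, |u s| := by
    intro k
    induction k with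
    | zero => simp
    | succ k ih =>
      rw [pow_succ, ← vecMul_vecMul, pow_succ', mul_assoc]
      refine (hr _ ?_).trans (mul_le_mul_of_nonneg_left ih hr0)
      rw [Matrix.sum_vecMul_of_mem_rowStochastic (pow_mem (pow_mem hP N) k), hu]
  have hbound : ∀ n : ℕ, |(u ᵥ* P ^ n) t| ≤ r ^ (n / N) * ∑ s, |u s| := by
    intro n
    have hmod := pow_mem hP (n % N)
    calc |(u ᵥ* P ^ n) t| ≤ ∑ t, |(u ᵥ* P ^ n) t| :=
          Finset.single_le_sum (f := fun t => |(u ᵥ* P ^ n) t|)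
            (fun _ _ => abs_nonneg _) (Finset.mem_univ t)
      _ = ∑ t, |((u ᵥ* (P ^ N) ^ (n / N)) ᵥ* P ^ (n % N)) t| := by
          rw [vecMul_vecMul, ← pow_mul, ← pow_add, Nat.div_add_mod]
      _ ≤ 1 * ∑ t, |(u ᵥ* (P ^ N) ^ (n / N)) t| :=
          Matrix.sum_abs_vecMul_le hmod.1 (sum_row_of_mem_rowStochastic hmod) _
      _ ≤ r ^ (n / N) * ∑ s, |u s| := by rw [one_mul]; exact hgeom _
  refine squeeze_zero_norm hbound ?_
  simpa using ((tendsto_pow_atTop_nhds_zero_of_lt_one hr0 hr1).comp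
    (Nat.tendsto_div_const_atTop hN)).mul_const (∑ s, |u s|)

/-- For an irreducible (strongly connected) and aperiodic finite Markov chain
with stationary probability vector `π`, the matrix powers converge:
`P^n(s,t) → π t` for all `s, t`; consequently the power-method iterates
`v_n = v₀ Pⁿ` converge to `π` for every initial probability vector `v₀`.
Aperiodicity of a state `s` is expressed as: every common divisor of
`{n > 0 | P^n(s,s) > 0}` equals `1` (i.e. the period, the gcd of this set,
is `1`). -/
theorem stmt15 {S : Type*} [Fintype S] [DecidableEq S] [Nonempty S]
    (P : Matrix S S ℝ) (hP : IsStochastic P)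
    (hirr : ∀ a b : S, Relation.ReflTransGen (fun x y => 0 < P x y) a b)
    (haper : ∀ s : S, ∀ d : ℕ, (∀ n : ℕ, 0 < n → 0 < (P ^ n) s s → d ∣ n) → d = 1)
    (π : S → ℝ) (hπ0 : ∀ s, 0 ≤ π s) (hπ1 : ∑ s, π s = 1)
    (hπstat : ∀ t, ∑ s, π s * P s t = π t) :
    (∀ s t : S, Tendsto (fun n : ℕ => (P ^ n) s t) atTop (𝓝 (π t))) ∧
    (∀ v₀ : S → ℝ, (∀ s, 0 ≤ v₀ s) → (∑ s, v₀ s = 1) →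
      ∀ t : S, Tendsto (fun n : ℕ => ∑ s, v₀ s * (P ^ n) s t) atTop (𝓝 (π t))) := by
  have hPs : P ∈ Matrix.rowStochastic ℝ S := Matrix.mem_rowStochastic_iff_sum.2 hP
  obtain ⟨N, hpos, hN⟩ :=
    ((Matrix.eventually_pow_pos hPs hirr haper).and (eventually_ne_atTop 0)).exists
  have hstat : ∀ n : ℕ, Matrix.vecMul π (P ^ n) = π := by
    intro n
    induction n with
    | zero => simp
    | succ n ih => rw [pow_succ, ← Matrix.vecMul_vecMul, ih]; exact funext hπstat
  have key : ∀ v₀ : S → ℝ, (∑ s, v₀ s = 1) →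
      ∀ t : S, Tendsto (fun n : ℕ => ∑ s, v₀ s * (P ^ n) s t) atTop (𝓝 (π t)) := by
    intro v₀ hv t
    have h := (Matrix.tendsto_vecMul_pow_zero hPs hN hpos (v₀ - π)
      (by simp [Finset.sum_sub_distrib, hv, hπ1]) t).add_const (π t)
    simp only [Matrix.sub_vecMul, hstat, Pi.sub_apply, sub_add_cancel, zero_add] at h
    exact h
  refine ⟨fun s t => ?_, fun v₀ _ hv => key v₀ hv⟩
  simpa [Pi.single_apply] using key (Pi.single s 1) (by simp) t
end

section
/- Let (S, P) be a finite Markov chain, T ⊆ S a target set, and S₀ the set of states from which no directed path in the transition graph leads to T. Then the function s ↦ ℙ_s(◇T), assigning to each state the probability that a path starting in s eventually visits T, is the unique function f : S → ℝ satisfying: f(s) = 1 for s ∈ T, f(s) = 0 for s ∈ S₀, and f(s) = Σ_{s'∈S} P(s,s') f(s') for all s ∈ S ∖ (T ∪ S₀). -/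
open Finset Filter Topology MeasureTheory

/-- Maximum principle: a function on a finite state space that is zero or harmonic at every state
is nonpositive if every state can reach one of its zeros. -/
theorem nonpos_of_zero_or_harmonic {S : Type*} [Fintype S] [Nonempty S]
    {P : Matrix S S ℝ} (hP : IsStochastic P) {d : S → ℝ}
    (hd : ∀ x, d x = 0 ∨ d x = ∑ y, P x y * d y)
    (hreach : ∀ x, ∃ t, d t = 0 ∧ Relation.ReflTransGen (fun x y => 0 < P x y) x t) (x : S) :
    d x ≤ 0 := by
  obtain ⟨m, hm⟩ := Finite.exists_max d
  refine (hm x).trans ?_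
  by_contra! hpos
  obtain ⟨t, ht, hpath⟩ := hreach m
  have key : d t = d m := by
    clear ht
    induction hpath with
    | refl => rfl
    | @tail b c _ hbc ih =>
      have hb : d b = ∑ y, P b y * d y := (hd b).resolve_left (by rw [ih]; exact hpos.ne')
      have hsum : ∑ y, P b y * (d m - d y) = 0 := by
        simp only [mul_sub, Finset.sum_sub_distrib, ← Finset.sum_mul, hP.2 b]
        linarith
      have hc := (Finset.sum_eq_zero_iff_of_nonneg fun y _ =>
        mul_nonneg (hP.1 b y) (sub_nonneg.2 (hm y))).1 hsum c (Finset.mem_univ c)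
      rcases mul_eq_zero.1 hc with h | h
      · exact absurd h hbc.ne'
      · linarith
  linarith

/-- The initial segments of sequences over a finite discrete type generate the product
σ-algebra. -/
theorem generateFrom_initialSegments {S : Type*} [Finite S] [MeasurableSpace S]
    [MeasurableSingletonClass S] :
    (MeasurableSpace.pi : MeasurableSpace (ℕ → S)) = MeasurableSpace.generateFrom
      {A | ∃ (n : ℕ) (w : ℕ → S), A = {ω | ∀ i ≤ n, ω i = w i}} := by
  apply le_antisymm
  · refine iSup_le fun n => ?_
    rintro _ ⟨B, -, rfl⟩
    have hB : (fun ω : ℕ → S => ω n) ⁻¹' B =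
        ⋃ w ∈ {w : Fin (n + 1) → S | w (Fin.last n) ∈ B},
          {ω | ∀ i ≤ n, ω i = w (Fin.ofNat (n + 1) i)} := by
      ext ω
      simp only [Set.mem_preimage, Set.mem_iUnion, Set.mem_ofPred_eq, exists_prop]
      constructor
      · intro h
        refine ⟨fun i => ω i, by simpa using h, fun i hi => ?_⟩
        simp [Nat.mod_eq_of_lt (Nat.lt_succ_of_le hi)]
      · rintro ⟨w, hw, h⟩
        rw [h n le_rfl]
        convert hw
        ext
        simp
    rw [hB]
    refine MeasurableSet.biUnion (m := MeasurableSpace.generateFrom _)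
      (Set.to_countable _) fun w _ => ?_
    exact MeasurableSpace.measurableSet_generateFrom ⟨n, _, rfl⟩
  · refine MeasurableSpace.generateFrom_le ?_
    rintro _ ⟨n, w, rfl⟩
    have : {ω : ℕ → S | ∀ i ≤ n, ω i = w i} =
        ⋂ i ∈ Set.Iic n, (fun ω : ℕ → S => ω i) ⁻¹' {w i} := by
      ext; simp
    rw [this]
    exact MeasurableSet.biInter (Set.to_countable _) fun i _ =>
      measurable_pi_apply i (measurableSet_singleton _)

theorem isPiSystem_initialSegments {S : Type*} :
    IsPiSystem {A : Set (ℕ → S) | ∃ (n : ℕ) (w : ℕ → S), A = {ω | ∀ i ≤ n, ω i = w i}} := by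
  rintro _ ⟨n, v, rfl⟩ _ ⟨m, w, rfl⟩ ⟨ω, hv, hw⟩
  refine ⟨max n m, ω, ?_⟩
  ext η
  simp only [Set.mem_inter_iff, Set.mem_ofPred_eq] at *
  constructor
  · rintro ⟨h1, h2⟩ i hi
    rcases le_max_iff.1 hi with h | h
    · rw [h1 i h, hv i h]
    · rw [h2 i h, hw i h]
  · intro h
    exact ⟨fun i hi => by rw [h i (le_max_of_le_left hi), hv i hi],
      fun i hi => by rw [h i (le_max_of_le_right hi), hw i hi]⟩

section Trajectory

variable {S : Type*} [Fintype S] [DecidableEq S] [MeasurableSpace S] [MeasurableSingletonClass S]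
  {P : Matrix S S ℝ} {μ : S → Measure (ℕ → S)}

theorem ae_eval_zero_eq (hμ : ∀ s, IsProbabilityMeasure (μ s))
    (hcyl : ∀ (s : S) (n : ℕ) (w : ℕ → S),
      μ s {ω | ∀ i ≤ n, ω i = w i} =
        (if w 0 = s then 1 else 0) *
          ∏ i ∈ Finset.range n, ENNReal.ofReal (P (w i) (w (i + 1)))) (s : S) :
    ∀ᵐ ω ∂μ s, ω 0 = s := by
  have h := hcyl s 0 fun _ => s
  have := hμ s
  have hmeas : MeasurableSet {ω : ℕ → S | ω 0 = s} :=
    (measurableSet_singleton s).preimage (measurable_pi_apply 0)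
  exact (mem_ae_iff_prob_eq_one hmeas).2 (by simpa using h)

/-- The Markov property at time one. -/
theorem map_shift_eq_sum (hP : IsStochastic P) (hμ : ∀ s, IsProbabilityMeasure (μ s))
    (hcyl : ∀ (s : S) (n : ℕ) (w : ℕ → S),
      μ s {ω | ∀ i ≤ n, ω i = w i} =
        (if w 0 = s then 1 else 0) *
          ∏ i ∈ Finset.range n, ENNReal.ofReal (P (w i) (w (i + 1)))) (s : S) :
    (μ s).map (fun ω n => ω (n + 1)) = ∑ s', ENNReal.ofReal (P s s') • μ s' := by
  have hmeas : Measurable fun (ω : ℕ → S) n => ω (n + 1) := by fun_prop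
  have := hμ s
  have : IsProbabilityMeasure ((μ s).map fun ω n => ω (n + 1)) :=
    Measure.isProbabilityMeasure_map hmeas.aemeasurable
  refine ext_of_generate_finite _ generateFrom_initialSegments isPiSystem_initialSegments ?_ ?_
  · rintro _ ⟨n, w, rfl⟩
    have hms : MeasurableSet {ω : ℕ → S | ∀ i ≤ n, ω i = w i} := by
      rw [generateFrom_initialSegments]
      exact MeasurableSpace.measurableSet_generateFrom ⟨n, w, rfl⟩
    rw [Measure.map_apply hmeas hms]
    have hae : (fun (ω : ℕ → S) n => ω (n + 1)) ⁻¹' {ω | ∀ i ≤ n, ω i = w i} =ᵐ[μ s]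
        {ω | ∀ i ≤ n + 1, ω i = (fun k => Nat.casesOn k s w : ℕ → S) i} := by
      filter_upwards [ae_eval_zero_eq hμ hcyl s] with ω h0
      refine propext ⟨fun h i hi => ?_, fun h i hi => h (i + 1) (by omega)⟩
      cases i with
      | zero => exact h0
      | succ k => exact h k (by omega)
    rw [measure_congr hae, hcyl, Finset.prod_range_succ']
    simp [hcyl, mul_comm]
  · have h1 : ∑ x, ENNReal.ofReal (P s x) = 1 := by
      rw [← ENNReal.ofReal_sum_of_nonneg fun x _ => hP.1 s x, hP.2 s, ENNReal.ofReal_one]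
    simp [h1]

theorem measure_preimage_shift (hP : IsStochastic P) (hμ : ∀ s, IsProbabilityMeasure (μ s))
    (hcyl : ∀ (s : S) (n : ℕ) (w : ℕ → S),
      μ s {ω | ∀ i ≤ n, ω i = w i} =
        (if w 0 = s then 1 else 0) *
          ∏ i ∈ Finset.range n, ENNReal.ofReal (P (w i) (w (i + 1)))) (s : S)
    {A : Set (ℕ → S)} (hA : MeasurableSet A) :
    μ s {ω | (fun n => ω (n + 1)) ∈ A} = ∑ s', ENNReal.ofReal (P s s') * μ s' A := by
  have h := congrArg (fun ν => ν A) (map_shift_eq_sum hP hμ hcyl s)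
  rw [Measure.map_apply (by fun_prop) hA] at h
  simpa [Set.preimage] using h

theorem measure_eval_mem_eq_zero (hP : IsStochastic P) (hμ : ∀ s, IsProbabilityMeasure (μ s))
    (hcyl : ∀ (s : S) (n : ℕ) (w : ℕ → S),
      μ s {ω | ∀ i ≤ n, ω i = w i} =
        (if w 0 = s then 1 else 0) *
          ∏ i ∈ Finset.range n, ENNReal.ofReal (P (w i) (w (i + 1)))) {T : Set S} (n : ℕ) :
    ∀ s, (∀ t ∈ T, ¬ Relation.ReflTransGen (fun x y => 0 < P x y) s t) →
      μ s {ω | ω n ∈ T} = 0 := by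
  induction n with
  | zero =>
    intro s hs
    refine measure_eq_zero_iff_ae_notMem.2 ?_
    filter_upwards [ae_eval_zero_eq hμ hcyl s] with ω h0 hT
    exact hs _ hT (by rw [h0])
  | succ n ih =>
    intro s hs
    have hmeas : MeasurableSet {ω : ℕ → S | ω n ∈ T} :=
      measurable_pi_apply n T.toFinite.measurableSet
    refine (measure_preimage_shift hP hμ hcyl s hmeas).trans (Finset.sum_eq_zero fun s' _ => ?_)
    rcases (hP.1 s s').eq_or_lt with h0 | hpos
    · simp [← h0]
    · rw [ih s' fun t ht hr => hs t ht (.head hpos hr), mul_zero]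

/-- The reachability probabilities are harmonic off the target. -/
theorem reachProb_eq_sum (hP : IsStochastic P) (hμ : ∀ s, IsProbabilityMeasure (μ s))
    (hcyl : ∀ (s : S) (n : ℕ) (w : ℕ → S),
      μ s {ω | ∀ i ≤ n, ω i = w i} =
        (if w 0 = s then 1 else 0) *
          ∏ i ∈ Finset.range n, ENNReal.ofReal (P (w i) (w (i + 1)))) {T : Set S} {s : S}
    (hs : s ∉ T) :
    (μ s {ω | ∃ n, ω n ∈ T}).toReal = ∑ s', P s s' * (μ s' {ω | ∃ n, ω n ∈ T}).toReal := by
  have hmeas : MeasurableSet {ω : ℕ → S | ∃ n, ω n ∈ T} := by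
    rw [Set.ofPred_exists]
    exact .iUnion fun n => measurable_pi_apply n T.toFinite.measurableSet
  have hae : {ω : ℕ → S | ∃ n, ω n ∈ T} =ᵐ[μ s]
      {ω | (fun n => ω (n + 1)) ∈ {ω : ℕ → S | ∃ n, ω n ∈ T}} := by
    filter_upwards [ae_eval_zero_eq hμ hcyl s] with ω h0
    refine propext ⟨?_, fun ⟨n, hn⟩ => ⟨n + 1, hn⟩⟩
    rintro ⟨_ | n, hn⟩
    · exact absurd (h0 ▸ hn) hs
    · exact ⟨n, hn⟩
  rw [measure_congr hae, measure_preimage_shift hP hμ hcyl s hmeas, ENNReal.toReal_sum]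
  · simp [ENNReal.toReal_mul, ENNReal.toReal_ofReal (hP.1 _ _)]
  · exact fun s' _ => ENNReal.mul_ne_top ENNReal.ofReal_ne_top (measure_ne_top _ _)

end Trajectory

/-- Fixed-point characterization of reachability probabilities: the function
`s ↦ ℙ_s(◇T)` is the unique `f : S → ℝ` with `f s = 1` on `T`, `f s = 0` on the
set `S₀` of states from which no path leads to `T`, and
`f s = ∑_{s'} P s s' · f s'` on the remaining states. The measure `μ s` is the
canonical trajectory measure started at `s`, characterized on cylinder sets. -/
theorem stmt16 {S : Type*} [Fintype S] [DecidableEq S] [Nonempty S]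
    [MeasurableSpace S] [MeasurableSingletonClass S]
    (P : Matrix S S ℝ) (hP : IsStochastic P)
    (μ : S → Measure (ℕ → S)) (hμ : ∀ s, IsProbabilityMeasure (μ s))
    (hcyl : ∀ (s : S) (n : ℕ) (w : ℕ → S),
      μ s {ω | ∀ i ≤ n, ω i = w i} =
        (if w 0 = s then 1 else 0) *
          ∏ i ∈ Finset.range n, ENNReal.ofReal (P (w i) (w (i + 1))))
    (T : Set S) :
    ∀ f : S → ℝ,
      ((∀ s ∈ T, f s = 1) ∧
       (∀ s : S, (∀ t ∈ T, ¬ Relation.ReflTransGen (fun x y => 0 < P x y) s t) →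
          f s = 0) ∧
       (∀ s : S, s ∉ T →
          (∃ t ∈ T, Relation.ReflTransGen (fun x y => 0 < P x y) s t) →
          f s = ∑ s', P s s' * f s'))
      ↔ f = fun s => (μ s {ω | ∃ n : ℕ, ω n ∈ T}).toReal := by
  have h1 : ∀ s ∈ T, (μ s {ω | ∃ n : ℕ, ω n ∈ T}).toReal = 1 := by
    intro s hs
    have : μ s {ω | ∃ n : ℕ, ω n ∈ T} = 1 := by
      rw [← measure_univ (μ := μ s)]
      refine measure_congr (eventuallyEq_univ.2 ?_)
      filter_upwards [ae_eval_zero_eq hμ hcyl s] with ω h0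
      exact ⟨0, h0.symm ▸ hs⟩
    simp [this]
  have h0 : ∀ s, (∀ t ∈ T, ¬ Relation.ReflTransGen (fun x y => 0 < P x y) s t) →
      (μ s {ω | ∃ n : ℕ, ω n ∈ T}).toReal = 0 := by
    intro s hs
    rw [Set.ofPred_exists,
      measure_iUnion_null fun n => measure_eval_mem_eq_zero hP hμ hcyl n s hs, ENNReal.toReal_zero]
  have nonpos : ∀ d : S → ℝ, (∀ s ∈ T, d s = 0) →
      (∀ s, (∀ t ∈ T, ¬ Relation.ReflTransGen (fun x y => 0 < P x y) s t) → d s = 0) →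
      (∀ s, s ∉ T → (∃ t ∈ T, Relation.ReflTransGen (fun x y => 0 < P x y) s t) →
        d s = ∑ s', P s s' * d s') → ∀ s, d s ≤ 0 := by
    intro d hT hS hh
    refine nonpos_of_zero_or_harmonic hP (fun x => ?_) fun x => ?_
    · by_cases hx : x ∈ T
      · exact .inl (hT x hx)
      by_cases hr : ∃ t ∈ T, Relation.ReflTransGen (fun x y => 0 < P x y) x t
      · exact .inr (hh x hx hr)
      · push Not at hr
        exact .inl (hS x hr)
    · by_cases hr : ∃ t ∈ T, Relation.ReflTransGen (fun x y => 0 < P x y) x t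
      · obtain ⟨t, ht, hr⟩ := hr
        exact ⟨t, hT t ht, hr⟩
      · push Not at hr
        exact ⟨x, hS x hr, .refl⟩
  intro f
  constructor
  · rintro ⟨hT, hS, hh⟩
    funext s
    apply le_antisymm
    · refine sub_nonpos.1 (nonpos (fun s => f s - (μ s {ω | ∃ n : ℕ, ω n ∈ T}).toReal)
        (fun s hs => ?_) (fun s hs => ?_) (fun s hs hr => ?_) s)
      · simp [hT s hs, h1 s hs]
      · simp [hS s hs, h0 s hs]
      · simp only [mul_sub, Finset.sum_sub_distrib]
        rw [hh s hs hr, reachProb_eq_sum hP hμ hcyl hs]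
    · refine sub_nonpos.1 (nonpos (fun s => (μ s {ω | ∃ n : ℕ, ω n ∈ T}).toReal - f s)
        (fun s hs => ?_) (fun s hs => ?_) (fun s hs hr => ?_) s)
      · simp [hT s hs, h1 s hs]
      · simp [hS s hs, h0 s hs]
      · simp only [mul_sub, Finset.sum_sub_distrib]
        rw [hh s hs hr, reachProb_eq_sum hP hμ hcyl hs]
  · rintro rfl
    exact ⟨h1, h0, fun s hs _ => reachProb_eq_sum hP hμ hcyl hs⟩
end
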